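/- arXiv:1506.01503 — 7 statements merged into one kernel-verified Lean document; each statement's English description precedes it below -/
import Mathlib

section
/- Let (R,B,L) be a Hadamard triple in ℤ^d and suppose the lattice ℤ[R,B] has full rank d but ℤ[R,B] ≠ ℤ^d. Let M be the invertible integer matrix with ℤ[R,B] = M(ℤ^d). Then R̃ := M⁻¹ R M has integer entries, B̃ := M⁻¹B ⊂ ℤ^d, L̃ := Mᵀ L ⊂ ℤ^d, the triple (R̃, B̃, L̃) is a Hadamard triple, and ℤ[R̃, B̃] = ℤ^d. -/
open MeasureTheory Matrix Filter
open scoped BigOperators Classical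

noncomputable section

variable {ι : Type*}

/-- Cast an integer matrix to a real matrix. -/
def intMatCast [Fintype ι] [DecidableEq ι] (R : Matrix ι ι ℤ) : Matrix ι ι ℝ :=
  R.map (Int.cast : ℤ → ℝ)

/-- Cast an integer vector to a real vector. -/
def intVecCast (v : ι → ℤ) : ι → ℝ := fun i => (v i : ℝ)

/-- Standard inner product on `ι → ℝ`. -/
def rdot [Fintype ι] (x y : ι → ℝ) : ℝ := ∑ i, x i * y i

/-- The exponential `e^{2πi⟨x,y⟩}`. -/
def expv [Fintype ι] (x y : ι → ℝ) : ℂ :=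
  Complex.exp (2 * (Real.pi : ℂ) * Complex.I * (rdot x y : ℝ))

/-- An integer matrix is expanding if all of its (complex) eigenvalues have modulus
strictly greater than `1`. -/
def IsExpanding [Fintype ι] [DecidableEq ι] (R : Matrix ι ι ℤ) : Prop :=
  ∀ z ∈ spectrum ℂ (R.map (Int.cast : ℤ → ℂ)), 1 < ‖z‖

/-- `(R,B,L)` is a Hadamard triple: `#B = #L` and the matrix
`(1/√N)(e^{2πi⟨R⁻¹b,ℓ⟩})_{ℓ∈L,b∈B}` is unitary, expressed via orthonormality of columns. -/
def IsHadamardTriple [Fintype ι] [DecidableEq ι] (R : Matrix ι ι ℤ)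
    (B L : Finset (ι → ℤ)) : Prop :=
  B.card = L.card ∧
  ∀ b ∈ B, ∀ b' ∈ B,
    (B.card : ℂ)⁻¹ * ∑ l ∈ L,
      expv ((intMatCast R)⁻¹.mulVec (intVecCast b)) (intVecCast l) *
        (starRingEnd ℂ) (expv ((intMatCast R)⁻¹.mulVec (intVecCast b')) (intVecCast l)) =
    if b = b' then 1 else 0

/-- `μ` is the self-affine measure `μ(R,B)`: a compactly supported Borel probability
measure satisfying `μ(E) = (1/N) ∑_{b∈B} μ(τ_b⁻¹(E))` where `τ_b(x) = R⁻¹(x+b)`. -/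
def IsSelfAffineMeasure [Fintype ι] [DecidableEq ι] (R : Matrix ι ι ℤ)
    (B : Finset (ι → ℤ)) (μ : Measure (ι → ℝ)) : Prop :=
  IsProbabilityMeasure μ ∧ (∃ K : Set (ι → ℝ), IsCompact K ∧ μ Kᶜ = 0) ∧
  ∀ E : Set (ι → ℝ), MeasurableSet E →
    μ E = (B.card : ENNReal)⁻¹ *
      ∑ b ∈ B, μ ((fun x => (intMatCast R)⁻¹.mulVec (x + intVecCast b)) ⁻¹' E)

/-- `Λ` is a spectrum for `μ`: it is countable and the exponentials `e^{2πi⟨λ,·⟩}`, `λ ∈ Λ`,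
form an orthonormal basis of `L²(μ)` (orthonormal and total). -/
def IsSpectrum [Fintype ι] [DecidableEq ι] (μ : Measure (ι → ℝ)) (Λ : Set (ι → ℝ)) : Prop :=
  Λ.Countable ∧
  (∀ l ∈ Λ, ∀ l' ∈ Λ,
    ∫ x, expv l x * (starRingEnd ℂ) (expv l' x) ∂μ = if l = l' then 1 else 0) ∧
  (∀ f : Lp ℂ 2 μ, (∀ l ∈ Λ, ∫ x, (starRingEnd ℂ) (expv l x) * f x ∂μ = 0) → f = 0)

/-- The Fourier transform `μ̂(ξ) = ∫ e^{-2πi⟨ξ,x⟩} dμ(x)`. -/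
def ftMeasure [Fintype ι] (μ : Measure (ι → ℝ)) (ξ : ι → ℝ) : ℂ :=
  ∫ x, Complex.exp (-(2 * (Real.pi : ℂ) * Complex.I * (rdot ξ x : ℝ))) ∂μ

/-- `u_B(x) = |(1/N) ∑_{b∈B} e^{2πi⟨b,x⟩}|²`. -/
def uB [Fintype ι] (B : Finset (ι → ℤ)) (x : ι → ℝ) : ℝ :=
  ‖(B.card : ℂ)⁻¹ * ∑ b ∈ B, expv (intVecCast b) x‖ ^ 2

/-- `𝒵 = {ξ : μ̂(ξ + k) = 0 for all k ∈ ℤ^d}`. -/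
def Zset [Fintype ι] (μ : Measure (ι → ℝ)) : Set (ι → ℝ) :=
  {ξ | ∀ k : ι → ℤ, ftMeasure μ (ξ + intVecCast k) = 0}

/-- `ℤ[R,B]`: the smallest `R`-invariant subgroup of `ℤ^d` containing all `R^j b`. -/
def ZRB [Fintype ι] [DecidableEq ι] (R : Matrix ι ι ℤ) (B : Finset (ι → ℤ)) :
    AddSubgroup (ι → ℤ) :=
  AddSubgroup.closure {v | ∃ (j : ℕ) (b : ι → ℤ), b ∈ B ∧ v = (R ^ j).mulVec b}

/-- `𝓛` is a complete set of representatives modulo `S(ℤ^d)`. -/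
def IsCompleteResidueSet [Fintype ι] [DecidableEq ι] (S : Matrix ι ι ℤ)
    (𝓛 : Finset (ι → ℤ)) : Prop :=
  ∀ v : ι → ℤ, ∃! l, l ∈ 𝓛 ∧ ∃ k : ι → ℤ, v - l = S.mulVec k


theorem mulVec_inj_of_det {d : ℕ} {M : Matrix (Fin d) (Fin d) ℤ} (hM : M.det ≠ 0) :
    Function.Injective (fun w : Fin d → ℤ => M.mulVec w) := by
  intro x y hxy
  have h : M.mulVec (x - y) = 0 := by
    rw [Matrix.mulVec_sub]; exact sub_eq_zero.2 hxy
  exact sub_eq_zero.1 (Matrix.eq_zero_of_mulVec_eq_zero hM h)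

/-- If `ℤ[R,B]` is full rank but not `ℤ^d`, conjugating by `M` with
`ℤ[R,B] = M(ℤ^d)` gives a Hadamard triple whose lattice is all of `ℤ^d`. -/
theorem conjugate_to_full_lattice {d : ℕ}
    (R M : Matrix (Fin d) (Fin d) ℤ) (B L : Finset (Fin d → ℤ))
    (hR : IsExpanding R) (hH : IsHadamardTriple R B L)
    (hfull : Submodule.span ℚ
        ((fun (v : Fin d → ℤ) => fun i => (v i : ℚ)) '' (ZRB R B : Set (Fin d → ℤ))) = ⊤)
    (hne : ZRB R B ≠ ⊤)
    (hM : M.det ≠ 0)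
    (hMZ : (ZRB R B : Set (Fin d → ℤ)) = Set.range (fun w => M.mulVec w)) :
    ∃ (Rt : Matrix (Fin d) (Fin d) ℤ) (Bt : Finset (Fin d → ℤ)),
      M * Rt = R * M ∧
      Bt.image (fun b => M.mulVec b) = B ∧
      IsHadamardTriple Rt Bt (L.image (fun l => Mᵀ.mulVec l)) ∧
      ZRB Rt Bt = ⊤ := by
  have hMinj : Function.Injective (fun w : Fin d → ℤ => M.mulVec w) :=
    mulVec_inj_of_det hM
  have hRinv : ∀ v ∈ ZRB R B, R.mulVec v ∈ ZRB R B := by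
    intro v hv
    unfold ZRB at hv ⊢
    induction hv using AddSubgroup.closure_induction with
    | mem x hx =>
      obtain ⟨j, b, hb, rfl⟩ := hx
      apply AddSubgroup.subset_closure
      exact ⟨j + 1, b, hb, by rw [Matrix.mulVec_mulVec, pow_succ']⟩
    | zero => rw [Matrix.mulVec_zero]; exact zero_mem _
    | add x y _ _ hx hy => rw [Matrix.mulVec_add]; exact add_mem hx hy
    | neg x _ hx => rw [Matrix.mulVec_neg]; exact neg_mem hx
  have hmem : ∀ v, v ∈ ZRB R B ↔ ∃ w, M.mulVec w = v := by
    intro v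
    rw [← SetLike.mem_coe, hMZ]; rfl
  have hcol : ∀ j : Fin d, ∃ w, M.mulVec w = R.mulVec (M.mulVec (Pi.single j 1)) := by
    intro j
    exact (hmem _).1 (hRinv _ ((hmem _).2 ⟨_, rfl⟩))
  choose c hc using hcol
  let Rt : Matrix (Fin d) (Fin d) ℤ := Matrix.of fun i j => c j i
  have hRt : M * Rt = R * M := by
    ext i j
    have h := congrFun (hc j) i
    rw [Matrix.mulVec_mulVec, Matrix.mulVec_single_one] at h
    exact h
  have hBmem : ∀ b ∈ B, b ∈ ZRB R B := fun b hb =>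
    AddSubgroup.subset_closure ⟨0, b, hb, by simp⟩
  let Bt : Finset (Fin d → ℤ) := B.preimage (fun w => M.mulVec w) hMinj.injOn
  have hBtm : ∀ b, b ∈ Bt ↔ M.mulVec b ∈ B := fun b => Finset.mem_preimage
  have hBt : Bt.image (fun b => M.mulVec b) = B := by
    ext b
    simp only [Finset.mem_image]
    constructor
    · rintro ⟨a, ha, rfl⟩
      exact (hBtm a).1 ha
    · intro hb
      obtain ⟨w, rfl⟩ := (hmem b).1 (hBmem b hb)
      exact ⟨w, (hBtm w).2 hb, rfl⟩
  have hMTinj : Function.Injective (fun w : Fin d → ℤ => Mᵀ.mulVec w) :=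
    mulVec_inj_of_det (by rwa [Matrix.det_transpose])
  have hpow : ∀ j : ℕ, M * Rt ^ j = R ^ j * M := by
    intro j
    induction j with
    | zero => simp
    | succ n ih => rw [pow_succ, ← mul_assoc, ih, mul_assoc, hRt, ← mul_assoc, ← pow_succ]
  have hcard : Bt.card = B.card := by
    rw [← hBt, Finset.card_image_of_injective _ hMinj]
  refine ⟨Rt, Bt, hRt, hBt, ⟨?_, ?_⟩, ?_⟩
  · rw [hcard, Finset.card_image_of_injective _ hMTinj, hH.1]
  · intro b hb b' hb'
    have key := hH.2 _ ((hBtm b).1 hb) _ ((hBtm b').1 hb')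
    rw [Finset.sum_image hMTinj.injOn, hcard]
    have hdetR : IsUnit (intMatCast M).det := by
      have : (intMatCast M).det = (M.det : ℝ) := by
        unfold intMatCast
        exact (Int.cast_det M).symm
      rw [this]
      exact isUnit_iff_ne_zero.2 (by exact_mod_cast hM)
    have hcm : ∀ X Y : Matrix (Fin d) (Fin d) ℤ,
        intMatCast (X * Y) = intMatCast X * intMatCast Y := fun X Y =>
      Matrix.map_mul (f := Int.castRingHom ℝ)
    have hcv : ∀ (X : Matrix (Fin d) (Fin d) ℤ) (v : Fin d → ℤ),
        intVecCast (X.mulVec v) = (intMatCast X).mulVec (intVecCast v) := by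
      intro X v
      ext i
      simp [intVecCast, intMatCast, Matrix.mulVec, dotProduct]
    have hinv : intMatCast M * (intMatCast Rt)⁻¹ = (intMatCast R)⁻¹ * intMatCast M := by
      have h1 : intMatCast R = intMatCast M * intMatCast Rt * (intMatCast M)⁻¹ := by
        rw [← hcm, hRt, hcm, mul_assoc, Matrix.mul_nonsing_inv _ hdetR, mul_one]
      rw [h1, Matrix.mul_inv_rev, Matrix.mul_inv_rev, Matrix.nonsing_inv_nonsing_inv _ hdetR,
        mul_assoc, mul_assoc, Matrix.nonsing_inv_mul _ hdetR, mul_one]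
    have hexp : ∀ a l : Fin d → ℤ,
        expv ((intMatCast Rt)⁻¹.mulVec (intVecCast a)) (intVecCast (Mᵀ.mulVec l)) =
        expv ((intMatCast R)⁻¹.mulVec (intVecCast (M.mulVec a))) (intVecCast l) := by
      intro a l
      have : rdot ((intMatCast Rt)⁻¹.mulVec (intVecCast a)) (intVecCast (Mᵀ.mulVec l)) =
        rdot ((intMatCast R)⁻¹.mulVec (intVecCast (M.mulVec a))) (intVecCast l) := by
        rw [hcv, hcv, Matrix.mulVec_mulVec, ← hinv, ← Matrix.mulVec_mulVec]
        have hT : intMatCast Mᵀ = (intMatCast M)ᵀ := rfl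
        rw [hT, Matrix.mulVec_transpose]
        change dotProduct _ _ = dotProduct _ _
        rw [dotProduct_comm, ← Matrix.dotProduct_mulVec, dotProduct_comm]
      unfold expv
      rw [this]
    simp only [hexp]
    rw [key]
    simp only [hMinj.eq_iff]
  · rw [eq_top_iff]
    intro w _
    have hmap : ∀ v ∈ ZRB R B, ∃ u ∈ ZRB Rt Bt, M.mulVec u = v := by
      intro v hv
      unfold ZRB at hv
      induction hv using AddSubgroup.closure_induction with
      | mem x hx =>
        obtain ⟨j, b, hb, rfl⟩ := hx
        obtain ⟨a, rfl⟩ := (hmem b).1 (hBmem b hb)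
        refine ⟨(Rt ^ j).mulVec a, AddSubgroup.subset_closure ⟨j, a, (hBtm a).2 hb, rfl⟩, ?_⟩
        rw [Matrix.mulVec_mulVec, Matrix.mulVec_mulVec, hpow]
      | zero => exact ⟨0, zero_mem _, Matrix.mulVec_zero _⟩
      | add x y _ _ hx hy =>
        obtain ⟨u, hu, rfl⟩ := hx
        obtain ⟨u', hu', rfl⟩ := hy
        exact ⟨u + u', add_mem hu hu', Matrix.mulVec_add _ _ _⟩
      | neg x _ hx =>
        obtain ⟨u, hu, rfl⟩ := hx
        exact ⟨-u, neg_mem hu, Matrix.mulVec_neg _ _⟩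
    obtain ⟨u, hu, huw⟩ := hmap _ ((hmem _).2 ⟨w, rfl⟩)
    rwa [← hMinj huw]

end
end

section
/- Let (R,B,L) be a Hadamard triple in ℤ^d and μ = μ(R,B) the self-affine measure. Then the set 𝒵 = {ξ ∈ ℝ^d : μ̂(ξ+k) = 0 for all k ∈ ℤ^d} is u_B-invariant: for every ξ ∈ 𝒵 and every ℓ ∈ ℤ^d with u_B((Rᵀ)⁻¹(ξ+ℓ)) > 0, the point (Rᵀ)⁻¹(ξ+ℓ) belongs to 𝒵. -/
open MeasureTheory Matrix Filter
open scoped BigOperators Classical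

noncomputable section

variable {ι : Type*}

lemma Zaux_exp_add_int {d : ℕ} (b k : Fin d → ℤ) (y : Fin d → ℝ) :
    expv (intVecCast b) (y + intVecCast k) = expv (intVecCast b) y := by
  have h : rdot (intVecCast b) (y + intVecCast k)
      = rdot (intVecCast b) y + ((∑ i, b i * k i : ℤ) : ℝ) := by
    simp [rdot, intVecCast, mul_add, Finset.sum_add_distrib]
  unfold expv
  rw [h, Complex.exp_eq_exp_iff_exists_int]
  refine ⟨∑ i, b i * k i, ?_⟩
  push_cast
  ring

lemma Zaux_rdot {d : ℕ} (x y : Fin d → ℝ) : rdot x y = x ⬝ᵥ y := rfl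

lemma Zaux_ft {d : ℕ} (R : Matrix (Fin d) (Fin d) ℤ) (B : Finset (Fin d → ℤ))
    (μ : Measure (Fin d → ℝ)) (hμ : IsSelfAffineMeasure R B μ) (hB : B.card ≠ 0)
    (hdet : IsUnit (intMatCast R).det) (y : Fin d → ℝ) :
    ftMeasure μ ((intMatCast Rᵀ).mulVec y) =
      (starRingEnd ℂ) ((B.card : ℂ)⁻¹ * ∑ b ∈ B, expv (intVecCast b) y) * ftMeasure μ y := by
  obtain ⟨hp, -, hE⟩ := hμ
  have hm : ∀ b : Fin d → ℤ,
      Continuous (fun x : Fin d → ℝ => (intMatCast R)⁻¹.mulVec (x + intVecCast b)) := by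
    intro b
    exact Continuous.matrix_mulVec continuous_const (by fun_prop)
  have hcont : ∀ z : Fin d → ℝ, Continuous (fun x : Fin d → ℝ =>
      Complex.exp (-(2 * (Real.pi : ℂ) * Complex.I * (rdot z x : ℝ)))) := by
    intro z
    unfold rdot
    fun_prop
  have hmeas : μ = (B.card : ENNReal)⁻¹ • ∑ b ∈ B,
      μ.map (fun x : Fin d → ℝ => (intMatCast R)⁻¹.mulVec (x + intVecCast b)) := by
    ext E hEm
    rw [hE E hEm]
    simp only [Measure.smul_apply, Measure.finsetSum_apply, smul_eq_mul]
    congr 1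
    refine Finset.sum_congr rfl fun b _ => ?_
    rw [Measure.map_apply (hm b).measurable hEm]
  have hkey : ∀ b x, rdot ((intMatCast Rᵀ).mulVec y)
      ((intMatCast R)⁻¹.mulVec (x + intVecCast b)) = rdot (intVecCast b) y + rdot y x := by
    intro b x
    have hT : intMatCast Rᵀ = (intMatCast R)ᵀ := rfl
    rw [Zaux_rdot, Zaux_rdot, Zaux_rdot, hT, mulVec_transpose, ← dotProduct_mulVec,
      mulVec_mulVec, mul_nonsing_inv _ hdet, one_mulVec, dotProduct_add,
      dotProduct_comm (intVecCast b) y, add_comm]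
  have hft : ftMeasure μ ((intMatCast Rᵀ).mulVec y) = (B.card : ℂ)⁻¹ * ∑ b ∈ B,
      ∫ x, Complex.exp (-(2 * (Real.pi : ℂ) * Complex.I *
        (rdot ((intMatCast Rᵀ).mulVec y)
          ((intMatCast R)⁻¹.mulVec (x + intVecCast b)) : ℝ))) ∂μ := by
    conv_lhs => rw [ftMeasure, hmeas]
    rw [integral_smul_measure, integral_finsetSum_measure]
    · rw [ENNReal.toReal_inv, ENNReal.toReal_natCast, Complex.real_smul]
      push_cast
      congr 1
      refine Finset.sum_congr rfl fun b _ => ?_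
      rw [integral_map (hm b).measurable.aemeasurable (hcont _).aestronglyMeasurable]
    · intro b _
      have : IsProbabilityMeasure (μ.map
          (fun x : Fin d → ℝ => (intMatCast R)⁻¹.mulVec (x + intVecCast b))) :=
        Measure.isProbabilityMeasure_map (hm b).measurable.aemeasurable
      refine Integrable.of_bound (hcont _).aestronglyMeasurable 1 (ae_of_all _ fun x => ?_)
      rw [Complex.norm_exp]
      simp
  rw [hft, map_mul, map_sum, map_inv₀, Complex.conj_natCast, mul_assoc (B.card : ℂ)⁻¹, Finset.sum_mul]
  congr 1
  refine Finset.sum_congr rfl fun b _ => ?_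
  rw [ftMeasure, ← integral_const_mul]
  congr 1
  ext x
  rw [hkey, expv, ← Complex.exp_conj, ← Complex.exp_add]
  congr 1
  have h2 : (starRingEnd ℂ) 2 = 2 := Complex.conj_ofNat 2
  simp [h2]
  ring

/-- The set `𝒵` is `u_B`-invariant. -/
theorem Zset_invariant {d : ℕ}
    (R : Matrix (Fin d) (Fin d) ℤ) (B L : Finset (Fin d → ℤ))
    (hR : IsExpanding R) (hH : IsHadamardTriple R B L)
    (μ : Measure (Fin d → ℝ)) (hμ : IsSelfAffineMeasure R B μ) :
    ∀ ξ ∈ Zset μ, ∀ l : Fin d → ℤ,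
      0 < uB B ((intMatCast Rᵀ)⁻¹.mulVec (ξ + intVecCast l)) →
      (intMatCast Rᵀ)⁻¹.mulVec (ξ + intVecCast l) ∈ Zset μ := by
  intro ξ hξ l hu k
  have hdet : IsUnit (intMatCast R).det := by
    have h0 : (0 : ℂ) ∉ spectrum ℂ (R.map (Int.cast : ℤ → ℂ)) := by
      intro h
      have := hR 0 h
      simp at this
      linarith
    rw [spectrum.zero_mem_iff, not_not, Matrix.isUnit_iff_isUnit_det, isUnit_iff_ne_zero] at h0
    have h1 : (R.map (Int.cast : ℤ → ℂ)).det = ((R.det : ℤ) : ℂ) :=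
      ((Int.castRingHom ℂ).map_det R).symm
    have h2 : (intMatCast R).det = ((R.det : ℤ) : ℝ) :=
      ((Int.castRingHom ℝ).map_det R).symm
    rw [h1] at h0
    rw [h2, isUnit_iff_ne_zero]
    exact_mod_cast h0
  have hdetT : IsUnit (intMatCast Rᵀ).det := by
    have hT : intMatCast Rᵀ = (intMatCast R)ᵀ := rfl
    rw [hT, det_transpose]
    exact hdet
  have hB : B.card ≠ 0 := by
    intro h
    simp [uB, h] at hu
  set η := (intMatCast Rᵀ)⁻¹.mulVec (ξ + intVecCast l) with hη
  have hx : (intMatCast Rᵀ).mulVec (η + intVecCast k)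
      = ξ + intVecCast (l + Rᵀ.mulVec k) := by
    rw [mulVec_add, hη, mulVec_mulVec, mul_nonsing_inv _ hdetT, one_mulVec, add_assoc]
    congr 1
    ext i
    simp [intVecCast, intMatCast, mulVec, dotProduct]
  have h := Zaux_ft R B μ hμ hB hdet (η + intVecCast k)
  rw [hx, hξ] at h
  simp only [Zaux_exp_add_int] at h
  rcases mul_eq_zero.mp h.symm with h | h
  · rw [map_eq_zero] at h
    simp [uB, h] at hu
  · exact h

end
end

section
/- Under the standing assumptions (block lower-triangular Hadamard triple with invariant set 𝒮 ⊆ 𝒵), the digit set B has the quasi-product form B = {(u_i, v_i + Q c_{i,j})ᵀ : 1 ≤ i ≤ N₁, 1 ≤ j ≤ |det R₂|}, where: (1) N₁ = N/|det R₂|; (2) Q is a (d−r)×(d−r) integer matrix with |det Q| ≥ 2 and R₂Q = Q R̃₂ for some (d−r)×(d−r) integer matrix R̃₂; (3) for each 1 ≤ i ≤ N₁ the set {Q c_{i,j} : 1 ≤ j ≤ |det R₂|} is a complete set of representatives (mod R₂(ℤ^{d−r})). Moreover, there exists L ≡ L₀ (mod Rᵀ(ℤ^d)) such that (R,B,L)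 is a Hadamard triple, and for every ℓ₂ ∈ π₂(L) and every b₁ ∈ π₁(B), the triples (R₁, π₁(B), L₁(ℓ₂)) and (R₂, B₂(b₁), π₂(L)) are Hadamard triples in ℤ^r and ℤ^{d−r} respectively. -/
open MeasureTheory Matrix Filter
open scoped BigOperators Classical

noncomputable section

variable {ι : Type*}

/-- First-component projection `π₁`. -/
def proj1 {r s : ℕ} {α : Type*} (x : Fin r ⊕ Fin s → α) : Fin r → α := x ∘ Sum.inl

/-- Second-component projection `π₂`. -/
def proj2 {r s : ℕ} {α : Type*} (x : Fin r ⊕ Fin s → α) : Fin s → α := x ∘ Sum.inr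

/-- `π₁(A)` for a finite set `A`. -/
def proj1Set {r s : ℕ} (A : Finset (Fin r ⊕ Fin s → ℤ)) : Finset (Fin r → ℤ) :=
  A.image proj1

/-- `π₂(A)` for a finite set `A`. -/
def proj2Set {r s : ℕ} (A : Finset (Fin r ⊕ Fin s → ℤ)) : Finset (Fin s → ℤ) :=
  A.image proj2

/-- `A₁(x₂) = {x ∈ ℤ^r : (x,x₂)ᵀ ∈ A}`. -/
def slice1 {r s : ℕ} (A : Finset (Fin r ⊕ Fin s → ℤ)) (x₂ : Fin s → ℤ) :
    Finset (Fin r → ℤ) :=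
  (A.filter (fun a => proj2 a = x₂)).image proj1

/-- `A₂(x₁) = {y ∈ ℤ^{d-r} : (x₁,y)ᵀ ∈ A}`. -/
def slice2 {r s : ℕ} (A : Finset (Fin r ⊕ Fin s → ℤ)) (x₁ : Fin r → ℤ) :
    Finset (Fin s → ℤ) :=
  (A.filter (fun a => proj1 a = x₁)).image proj2

/-- The slab `ℝ^r × {(R₂ᵀ)^k y₀} + ℤ^d`. -/
def slabLevel (r : ℕ) {s : ℕ} (R₂ : Matrix (Fin s) (Fin s) ℤ) (y₀ : Fin s → ℝ) (k : ℕ) :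
    Set (Fin r ⊕ Fin s → ℝ) :=
  {x | ∃ z : Fin r ⊕ Fin s → ℤ,
    proj2 (x - intVecCast z) = ((intMatCast R₂ᵀ) ^ k).mulVec y₀}

set_option linter.unusedSectionVars false

/-- the exponential `e^{2πix}` -/
def ee (x : ℝ) : ℂ := Complex.exp (2 * (Real.pi : ℂ) * Complex.I * (x : ℂ))

lemma expv_eq [Fintype ι] (x y : ι → ℝ) : expv x y = ee (x ⬝ᵥ y) := rfl

lemma ee_add (x y : ℝ) : ee (x + y) = ee x * ee y := by
  unfold ee
  rw [← Complex.exp_add]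
  push_cast
  ring_nf

lemma ee_conj (x : ℝ) : (starRingEnd ℂ) (ee x) = ee (-x) := by
  unfold ee
  rw [← Complex.exp_conj]
  simp [map_ofNat]

lemma ee_zero : ee 0 = 1 := by simp [ee]

lemma ee_norm (x : ℝ) : ‖ee x‖ = 1 := by
  unfold ee
  have : 2 * (Real.pi : ℂ) * Complex.I * (x : ℂ) = ((2 * Real.pi * x : ℝ) : ℂ) * Complex.I := by
    push_cast; ring
  rw [this, Complex.norm_exp_ofReal_mul_I]

lemma ee_ne_zero (x : ℝ) : ee x ≠ 0 := Complex.exp_ne_zero _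

lemma ee_eq_one_iff (x : ℝ) : ee x = 1 ↔ ∃ n : ℤ, x = n := by
  unfold ee
  rw [Complex.exp_eq_one_iff]
  have h : (2 * (Real.pi : ℂ) * Complex.I) ≠ 0 := Complex.two_pi_I_ne_zero
  constructor
  · rintro ⟨n, hn⟩
    refine ⟨n, ?_⟩
    rw [mul_comm (n : ℂ)] at hn
    exact_mod_cast mul_left_cancel₀ h hn
  · rintro ⟨n, rfl⟩
    exact ⟨n, by push_cast; ring⟩

lemma ee_int (n : ℤ) : ee n = 1 := (ee_eq_one_iff _).2 ⟨n, rfl⟩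

lemma ee_mul_conj (x y : ℝ) : ee x * (starRingEnd ℂ) (ee y) = ee (x - y) := by
  rw [ee_conj, ← ee_add, sub_eq_add_neg]

lemma ee_eq_iff (x y : ℝ) : ee x = ee y ↔ ∃ n : ℤ, x - y = n := by
  rw [← ee_eq_one_iff]
  have h := ee_ne_zero y
  have : ee x = ee (x - y) * ee y := by rw [← ee_add]; simp
  rw [this]
  constructor
  · intro h'
    exact mul_right_cancel₀ h (by rw [h', one_mul])
  · intro h'
    rw [h', one_mul]

section vec
variable [Fintype ι]

lemma ivc_add (a b : ι → ℤ) : intVecCast (a + b) = intVecCast a + intVecCast b := by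
  ext i; simp [intVecCast]

lemma ivc_sub (a b : ι → ℤ) : intVecCast (a - b) = intVecCast a - intVecCast b := by
  ext i; simp [intVecCast]

lemma ivc_inj {a b : ι → ℤ} (h : intVecCast a = intVecCast b) : a = b := by
  ext i
  have := congrFun h i
  simpa [intVecCast] using this

lemma ivc_dot (a b : ι → ℤ) : intVecCast a ⬝ᵥ intVecCast b = ((a ⬝ᵥ b : ℤ) : ℝ) := by
  simp [dotProduct, intVecCast]

variable [DecidableEq ι]

lemma ivc_mulVec (S : Matrix ι ι ℤ) (k : ι → ℤ) :
    intVecCast (S.mulVec k) = (intMatCast S).mulVec (intVecCast k) := by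
  ext i
  simp [intVecCast, intMatCast, mulVec, dotProduct]

lemma imc_det (S : Matrix ι ι ℤ) : (intMatCast S).det = (S.det : ℝ) := by
  unfold intMatCast
  exact (Int.cast_det S).symm

lemma imc_transpose (S : Matrix ι ι ℤ) : intMatCast Sᵀ = (intMatCast S)ᵀ := rfl

lemma imc_unit {S : Matrix ι ι ℤ} (h : S.det ≠ 0) : IsUnit (intMatCast S).det := by
  rw [imc_det]; exact IsUnit.mk0 _ (by exact_mod_cast h)

lemma imc_mul_inv {S : Matrix ι ι ℤ} (h : S.det ≠ 0) (x : ι → ℝ) :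
    (intMatCast S).mulVec ((intMatCast S)⁻¹.mulVec x) = x := by
  rw [mulVec_mulVec, mul_nonsing_inv _ (imc_unit h), one_mulVec]

lemma imc_inv_mul {S : Matrix ι ι ℤ} (h : S.det ≠ 0) (x : ι → ℝ) :
    (intMatCast S)⁻¹.mulVec ((intMatCast S).mulVec x) = x := by
  rw [mulVec_mulVec, nonsing_inv_mul _ (imc_unit h), one_mulVec]

lemma det_ne_zero_of_expanding {S : Matrix ι ι ℤ} (h : IsExpanding S) : S.det ≠ 0 := by
  intro h0
  have h1 : (0 : ℂ) ∈ spectrum ℂ (S.map (Int.cast : ℤ → ℂ)) := by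
    rw [spectrum.zero_mem_iff, Matrix.isUnit_iff_isUnit_det]
    have : (S.map (Int.cast : ℤ → ℂ)).det = (S.det : ℂ) := (Int.cast_det S).symm
    rw [this, h0]
    simp
  have := h 0 h1
  norm_num at this

lemma det_pow_sub_one {S : Matrix ι ι ℤ} (h : IsExpanding S) {m : ℕ} (hm : 1 ≤ m) :
    (S ^ m - 1).det ≠ 0 := by
  intro h0
  have h1 : (1 : ℂ) ∈ spectrum ℂ ((S.map (Int.cast : ℤ → ℂ)) ^ m) := by
    rw [spectrum.mem_iff, Matrix.isUnit_iff_isUnit_det]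
    have e : (algebraMap ℂ (Matrix ι ι ℂ) 1 - (S.map (Int.cast : ℤ → ℂ)) ^ m)
        = -((Int.castRingHom ℂ).mapMatrix (S ^ m - 1)) := by
      rw [map_sub, map_pow, map_one]
      simp
    rw [e, Matrix.det_neg, ← RingHom.map_det, h0]
    simp
  rw [spectrum.map_pow_of_pos _ (by omega)] at h1
  obtain ⟨z, hz, hz1⟩ := h1
  have h2 := h z hz
  have h3 : ‖z‖ ^ m = 1 := by
    have hz1' : z ^ m = 1 := hz1
    rw [← norm_pow, hz1', norm_one]
  have := one_lt_pow₀ h2 (by omega : m ≠ 0)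
  linarith

/-- pairing `⟨S⁻¹ b, l⟩` -/
def pr (S : Matrix ι ι ℤ) (b l : ι → ℤ) : ℝ :=
  ((intMatCast S)⁻¹.mulVec (intVecCast b)) ⬝ᵥ (intVecCast l)

lemma pr_sub_left (S : Matrix ι ι ℤ) (b b' l : ι → ℤ) :
    pr S (b - b') l = pr S b l - pr S b' l := by
  unfold pr; rw [ivc_sub, mulVec_sub, sub_dotProduct]

lemma pr_sub_right (S : Matrix ι ι ℤ) (b l l' : ι → ℤ) :
    pr S b (l - l') = pr S b l - pr S b l' := by
  unfold pr; rw [ivc_sub, dotProduct_sub]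

lemma pr_add_right (S : Matrix ι ι ℤ) (b l l' : ι → ℤ) :
    pr S b (l + l') = pr S b l + pr S b l' := by
  unfold pr; rw [ivc_add, dotProduct_add]

lemma pr_mulVec_left {S : Matrix ι ι ℤ} (h : S.det ≠ 0) (k l : ι → ℤ) :
    pr S (S.mulVec k) l = ((k ⬝ᵥ l : ℤ) : ℝ) := by
  unfold pr; rw [ivc_mulVec, imc_inv_mul h, ivc_dot]

lemma pr_eq_right (S : Matrix ι ι ℤ) (b l : ι → ℤ) :
    pr S b l = (intVecCast b) ⬝ᵥ ((intMatCast Sᵀ)⁻¹.mulVec (intVecCast l)) := by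
  unfold pr
  rw [imc_transpose, ← transpose_nonsing_inv, mulVec_transpose, dotProduct_comm,
    dotProduct_mulVec, dotProduct_comm]

lemma pr_mulVec_right {S : Matrix ι ι ℤ} (h : S.det ≠ 0) (b k : ι → ℤ) :
    pr S b (Sᵀ.mulVec k) = ((b ⬝ᵥ k : ℤ) : ℝ) := by
  rw [pr_eq_right, ivc_mulVec, imc_inv_mul (by rwa [det_transpose]), ivc_dot]

lemma hadamard_iff {S : Matrix ι ι ℤ} {B L : Finset (ι → ℤ)} :
    IsHadamardTriple S B L ↔ B.card = L.card ∧ ∀ b ∈ B, ∀ b' ∈ B,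
      (B.card : ℂ)⁻¹ * ∑ l ∈ L, ee (pr S (b - b') l) = if b = b' then 1 else 0 := by
  unfold IsHadamardTriple
  simp only [expv_eq, ee_mul_conj, pr_sub_left]
  rfl

/-- The integer lattice `S ℤ^d`. -/
def latt (S : Matrix ι ι ℤ) : Submodule ℤ (ι → ℤ) := LinearMap.range S.mulVecLin

lemma mem_latt {S : Matrix ι ι ℤ} {v : ι → ℤ} : v ∈ latt S ↔ ∃ k, v = S.mulVec k := by
  simp [latt, eq_comm]

lemma card_latt {S : Matrix ι ι ℤ} (h : S.det ≠ 0) :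
    Nat.card ((ι → ℤ) ⧸ latt S) = S.det.natAbs := by
  have hinj : Function.Injective S.mulVecLin := by
    rw [← LinearMap.ker_eq_bot, LinearMap.ker_eq_bot']
    intro v hv
    by_contra hne
    exact h (Matrix.exists_mulVec_eq_zero_iff.1 ⟨v, hne, hv⟩)
  have := Submodule.natAbs_det_equiv (latt S) (LinearEquiv.ofInjective S.mulVecLin hinj)
  rw [← this]
  rw [← LinearMap.det_toLin' S]
  rfl

lemma finite_latt {S : Matrix ι ι ℤ} (h : S.det ≠ 0) : Finite ((ι → ℤ) ⧸ latt S) := by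
  apply Nat.finite_of_card_ne_zero
  rw [card_latt h]
  simpa using h

lemma exists_residues {S : Matrix ι ι ℤ} (h : S.det ≠ 0) :
    ∃ 𝓛 : Finset (ι → ℤ), IsCompleteResidueSet S 𝓛 := by
  have := finite_latt h
  have := Fintype.ofFinite ((ι → ℤ) ⧸ latt S)
  refine ⟨Finset.univ.image (fun q : (ι → ℤ) ⧸ latt S => Quotient.out q), fun v => ?_⟩
  refine ⟨Quotient.out (Submodule.Quotient.mk v : (ι → ℤ) ⧸ latt S), ⟨?_, ?_⟩, ?_⟩
  · simp
  · rw [← mem_latt, ← Submodule.Quotient.eq]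
    exact (Quotient.out_eq _).symm
  · rintro l ⟨hl, hk⟩
    simp only [Finset.mem_image, Finset.mem_univ, true_and] at hl
    obtain ⟨q, rfl⟩ := hl
    rw [← mem_latt, ← Submodule.Quotient.eq] at hk
    rw [hk]
    congr 1
    exact (Quotient.out_eq q).symm

/-- character sum over the quotient -/
lemma char_sum {S : Matrix ι ι ℤ} (h : S.det ≠ 0) [Fintype ((ι → ℤ) ⧸ latt Sᵀ)] (w : ι → ℤ) :
    ∑ q : (ι → ℤ) ⧸ latt Sᵀ, ee (pr S w (Quotient.out q)) =
      if w ∈ latt S then (Fintype.card ((ι → ℤ) ⧸ latt Sᵀ) : ℂ) else 0 := by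
  split_ifs with hw
  · obtain ⟨k, rfl⟩ := mem_latt.1 hw
    simp only [pr_mulVec_left h, ee_int]
    simp
  · have key : ∃ e : ι → ℤ, ee (pr S w e) ≠ 1 := by
      by_contra hcon
      push Not at hcon
      apply hw
      have hint : ∀ i, ∃ n : ℤ, ((intMatCast S)⁻¹.mulVec (intVecCast w)) i = n := by
        intro i
        have := (ee_eq_one_iff _).1 (hcon (Pi.single i 1))
        unfold pr at this
        have e1 : intVecCast (Pi.single i (1 : ℤ)) = Pi.single i (1 : ℝ) := by
          ext j
          by_cases hj : j = i
          · subst hj; simp [intVecCast]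
          · simp [intVecCast, hj]
        rw [e1, dotProduct_single_one] at this
        exact this
      choose n hn using hint
      refine mem_latt.2 ⟨n, ?_⟩
      apply ivc_inj
      rw [ivc_mulVec]
      have : intVecCast n = ((intMatCast S)⁻¹.mulVec (intVecCast w)) := by
        ext i; rw [hn]; rfl
      rw [this, imc_mul_inv h]
    obtain ⟨e, he⟩ := key
    have hper : ∀ v v' : ι → ℤ, (Submodule.Quotient.mk v : (ι → ℤ) ⧸ latt Sᵀ) =
        Submodule.Quotient.mk v' → ee (pr S w v) = ee (pr S w v') := by
      intro v v' hv
      rw [Submodule.Quotient.eq] at hv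
      obtain ⟨k, hk⟩ := mem_latt.1 hv
      rw [ee_eq_iff]
      refine ⟨w ⬝ᵥ k, ?_⟩
      rw [← pr_sub_right, hk, pr_mulVec_right h]
    have hmk : ∀ q : (ι → ℤ) ⧸ latt Sᵀ, Submodule.Quotient.mk (Quotient.out q) = q :=
      fun q => Quotient.out_eq q
    have hs := Equiv.sum_comp (Equiv.addRight (Submodule.Quotient.mk e : (ι → ℤ) ⧸ latt Sᵀ))
      (fun q => ee (pr S w (Quotient.out q)))
    have ht : ∀ q : (ι → ℤ) ⧸ latt Sᵀ,
        ee (pr S w (Quotient.out (Equiv.addRight (Submodule.Quotient.mk e) q))) =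
        ee (pr S w (Quotient.out q)) * ee (pr S w e) := by
      intro q
      rw [← ee_add, ← pr_add_right]
      apply hper
      rw [hmk, Submodule.Quotient.mk_add, hmk]
      rfl
    simp only [ht] at hs
    rw [← Finset.sum_mul] at hs
    by_contra hne
    exact he (mul_left_cancel₀ hne (by rw [hs, mul_one]))

end vec

/-- column orthogonality implies row orthogonality. -/
lemma rows_of_cols {α β : Type*} [DecidableEq α] [DecidableEq β] (X : Finset α) (Y : Finset β) (hc : X.card = Y.card)
    (φ : α → β → ℂ) (c : ℂ) (hc0 : c ≠ 0)
    (h : ∀ b ∈ X, ∀ b' ∈ X, ∑ l ∈ Y, φ b l * (starRingEnd ℂ) (φ b' l) = if b = b' then c else 0) :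
    ∀ l ∈ Y, ∀ l' ∈ Y, ∑ b ∈ X, φ b l * (starRingEnd ℂ) (φ b l') = if l = l' then c else 0 := by
  let A : Matrix X Y ℂ := fun b l => φ b l
  let D : Matrix Y X ℂ := fun l b => c⁻¹ * (starRingEnd ℂ) (φ b l)
  have hAD : A * D = 1 := by
    ext b b'
    rw [Matrix.mul_apply, Finset.sum_coe_sort Y (fun l => φ b l * (c⁻¹ * (starRingEnd ℂ) (φ b' l)))]
    have := h b b.2 b' b'.2
    have e : ∀ l, φ b l * (c⁻¹ * (starRingEnd ℂ) (φ b' l)) =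
      c⁻¹ * (φ b l * (starRingEnd ℂ) (φ b' l)) := fun l => by ring
    simp only [e]
    rw [← Finset.mul_sum, this, Matrix.one_apply]
    by_cases hb : b = b'
    · simp [hb, hc0]
    · have : (b : α) ≠ b' := fun h => hb (Subtype.ext h)
      simp [hb, this]
  have hDA : D * A = 1 := (Matrix.mul_eq_one_comm_of_card_eq _ _ _ (by simpa using hc)).1 hAD
  intro l hl l' hl'
  have := congrFun (congrFun hDA ⟨l', hl'⟩) ⟨l, hl⟩
  rw [Matrix.mul_apply, Finset.sum_coe_sort X (fun b => (c⁻¹ * (starRingEnd ℂ) (φ b l')) * φ b l)]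
    at this
  have e : ∀ b, (c⁻¹ * (starRingEnd ℂ) (φ b l')) * φ b l =
      c⁻¹ * (φ b l * (starRingEnd ℂ) (φ b l')) := fun b => by ring
  simp only [e] at this
  rw [← Finset.mul_sum, Matrix.one_apply] at this
  rw [inv_mul_eq_iff_eq_mul₀ hc0] at this
  rw [this]
  by_cases hl : l = l'
  · simp [hl]
  · have : l' ≠ l := fun h => hl h.symm
    simp [hl, this]

lemma card_le_of_rows {α β : Type*} [DecidableEq α] [DecidableEq β] (X : Finset α) (Y : Finset β)
    (φ : α → β → ℂ) (c : ℂ) (hc0 : c ≠ 0)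
    (h : ∀ l ∈ Y, ∀ l' ∈ Y, ∑ b ∈ X, φ b l * (starRingEnd ℂ) (φ b l') = if l = l' then c else 0) :
    Y.card ≤ X.card := by
  let A : Matrix X Y ℂ := fun b l => c⁻¹ * (starRingEnd ℂ) (φ b l)
  let D : Matrix Y X ℂ := fun l b => φ b l
  have hDA : D * A = 1 := by
    ext l l'
    rw [Matrix.mul_apply, Finset.sum_coe_sort X (fun b => φ b l * (c⁻¹ * (starRingEnd ℂ) (φ b l')))]
    have := h l l.2 l' l'.2
    have e : ∀ b, φ b l * (c⁻¹ * (starRingEnd ℂ) (φ b l')) =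
      c⁻¹ * (φ b l * (starRingEnd ℂ) (φ b l')) := fun l => by ring
    simp only [e]
    rw [← Finset.mul_sum, this, Matrix.one_apply]
    by_cases hb : l = l'
    · simp [hb, hc0]
    · have : (l : β) ≠ l' := fun h => hb (Subtype.ext h)
      simp [hb, this]
  have h1 : (D * A).rank ≤ D.rank := Matrix.rank_mul_le_left D A
  rw [hDA, Matrix.rank_one] at h1
  have h2 := Matrix.rank_le_card_width D
  simpa using h1.trans h2

lemma char_indep {r : ℕ} (P : Finset (Fin r → ℤ)) (A : (Fin r → ℤ) → ℂ)
    (h : ∀ x : Fin r → ℝ, ∑ p ∈ P, A p * ee (intVecCast p ⬝ᵥ x) = 0) : ∀ p ∈ P, A p = 0 := by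
  let χ : (Fin r → ℤ) → (Multiplicative (Fin r → ℝ) →* ℂ) := fun p =>
    { toFun := fun x => ee (intVecCast p ⬝ᵥ x.toAdd)
      map_one' := by simp [ee_zero]
      map_mul' := fun x y => by rw [toAdd_mul, dotProduct_add, ee_add] }
  have hχ : Function.Injective χ := by
    intro p q hpq
    by_contra hne
    obtain ⟨i, hi⟩ := Function.ne_iff.1 hne
    have h1 := DFunLike.congr_fun hpq
      (Multiplicative.ofAdd (Pi.single i (1 / (2 * ((p i : ℝ) - q i)))))
    have h2 : ee (intVecCast p ⬝ᵥ Pi.single i (1 / (2 * ((p i : ℝ) - q i)))) =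
      ee (intVecCast q ⬝ᵥ Pi.single i (1 / (2 * ((p i : ℝ) - q i)))) := h1
    rw [ee_eq_iff] at h2
    obtain ⟨n, hn⟩ := h2
    rw [dotProduct_single, dotProduct_single, ← sub_mul] at hn
    have hi' : (p i : ℝ) - q i ≠ 0 := by
      rw [sub_ne_zero]; exact_mod_cast hi
    have h3 : (intVecCast p i - intVecCast q i) * (1 / (2 * ((p i : ℝ) - q i))) = 1 / 2 := by
      unfold intVecCast
      field_simp
    rw [h3] at hn
    have h4 : (1 : ℝ) = 2 * n := by linarith
    have h5 : (1 : ℤ) = 2 * n := by exact_mod_cast h4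
    omega
  have li := (linearIndependent_monoidHom (Multiplicative (Fin r → ℝ)) ℂ).comp χ hχ
  rw [linearIndependent_iff'] at li
  apply li P A
  ext x
  have := h x.toAdd
  simpa [χ] using this

section four
variable [Fintype ι] [DecidableEq ι]

lemma fourier_fiber {S : Matrix ι ι ℤ} (hS : S.det ≠ 0) (B' : Finset (ι → ℤ)) (y : ι → ℝ)
    (hne : B'.Nonempty) (hinj : ∀ b ∈ B', ∀ b' ∈ B', b - b' ∈ latt S → b = b')
    (h : ∀ l, l ∉ latt Sᵀ → ∑ b ∈ B', ee (intVecCast b ⬝ᵥ y) * ee (pr S b l) = 0) :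
    (∀ a, ∃ b ∈ B', a - b ∈ latt S) ∧
      ∀ b ∈ B', ∀ b' ∈ B', ∃ n : ℤ, intVecCast (b - b') ⬝ᵥ y = n := by
  have hfin := finite_latt (S := Sᵀ) (by rwa [det_transpose])
  have := Fintype.ofFinite ((ι → ℤ) ⧸ latt Sᵀ)
  set M : ℂ := (Fintype.card ((ι → ℤ) ⧸ latt Sᵀ) : ℂ) with hM
  have hM0 : M ≠ 0 := by
    rw [hM]; exact_mod_cast Fintype.card_ne_zero
  set G : ℂ := ∑ b ∈ B', ee (intVecCast b ⬝ᵥ y) with hG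
  have key : ∀ a : ι → ℤ, ∑ b ∈ B', ee (intVecCast b ⬝ᵥ y) * (if b - a ∈ latt S then M else 0) = G := by
    intro a
    have h1 : ∑ q : (ι → ℤ) ⧸ latt Sᵀ, ∑ b ∈ B', ee (intVecCast b ⬝ᵥ y) *
        ee (pr S (b - a) (Quotient.out q)) = G := by
      rw [Finset.sum_eq_single (0 : (ι → ℤ) ⧸ latt Sᵀ)]
      · have h0 : Quotient.out (0 : (ι → ℤ) ⧸ latt Sᵀ) ∈ latt Sᵀ := by
          rw [← Submodule.Quotient.mk_eq_zero]
          exact Quotient.out_eq _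
        obtain ⟨k, hk⟩ := mem_latt.1 h0
        rw [hk]
        simp only [pr_mulVec_right hS, ee_int, mul_one]
        rfl
      · intro q _ hq
        have h0 : Quotient.out q ∉ latt Sᵀ := by
          rw [← Submodule.Quotient.mk_eq_zero]
          intro h'
          exact hq (by rw [← h']; exact (Quotient.out_eq _).symm)
        have h2 := h _ h0
        have : ∀ b, ee (intVecCast b ⬝ᵥ y) * ee (pr S (b - a) (Quotient.out q)) =
            (ee (intVecCast b ⬝ᵥ y) * ee (pr S b (Quotient.out q))) *
              ee (-pr S a (Quotient.out q)) := by
          intro b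
          rw [pr_sub_left, sub_eq_add_neg, ee_add]; ring
        simp only [this]
        rw [← Finset.sum_mul, h2, zero_mul]
      · simp
    rw [Finset.sum_comm] at h1
    simp only [← Finset.mul_sum, char_sum hS] at h1
    exact h1
  have single : ∀ b ∈ B', G = ee (intVecCast b ⬝ᵥ y) * M := by
    intro b hb
    rw [← key b, Finset.sum_eq_single b]
    · simp
    · intro b' hb' hbb
      have : b' - b ∉ latt S := fun h' => hbb (hinj _ hb' _ hb h')
      simp [this]
    · intro h'; exact absurd hb h'
  constructor
  · intro a
    by_contra hcon
    push Not at hcon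
    obtain ⟨b, hb⟩ := hne
    have h1 := key a
    rw [Finset.sum_eq_zero] at h1
    · have := single b hb
      rw [← h1] at this
      exact mul_ne_zero (ee_ne_zero _) hM0 this.symm
    · intro b' hb'
      have : b' - a ∉ latt S := fun h' => hcon b' hb' (by
        have := (latt S).neg_mem h'
        rwa [neg_sub] at this)
      simp [this]
  · intro b hb b' hb'
    have h1 := (single b hb).symm.trans (single b' hb')
    have h2 := (ee_eq_iff _ _).1 (mul_right_cancel₀ hM0 h1)
    rwa [ivc_sub, sub_dotProduct]

lemma card_le_residues {S : Matrix ι ι ℤ} (hS : S.det ≠ 0) (B' : Finset (ι → ℤ))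
    (hinj : ∀ b ∈ B', ∀ b' ∈ B', b - b' ∈ latt S → b = b') : B'.card ≤ S.det.natAbs := by
  have := finite_latt hS
  have hi : Function.Injective (fun b : B' => (Submodule.Quotient.mk (b : ι → ℤ) : (ι → ℤ) ⧸ latt S)) := by
    intro b b' hbb
    exact Subtype.ext (hinj b b.2 b' b'.2 ((Submodule.Quotient.eq _).1 hbb))
  have := Nat.card_le_card_of_injective _ hi
  rw [card_latt hS] at this
  simpa using this

lemma card_eq_residues {S : Matrix ι ι ℤ} (hS : S.det ≠ 0) (B' : Finset (ι → ℤ))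
    (hinj : ∀ b ∈ B', ∀ b' ∈ B', b - b' ∈ latt S → b = b')
    (hsur : ∀ a, ∃ b ∈ B', a - b ∈ latt S) : B'.card = S.det.natAbs := by
  apply le_antisymm (card_le_residues hS B' hinj)
  have hi : Function.Surjective (fun b : B' => (Submodule.Quotient.mk (b : ι → ℤ) : (ι → ℤ) ⧸ latt S)) := by
    intro q
    obtain ⟨a, rfl⟩ := Submodule.Quotient.mk_surjective _ q
    obtain ⟨b, hb, hab⟩ := hsur a
    exact ⟨⟨b, hb⟩, ((Submodule.Quotient.eq _).2 hab).symm⟩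
  have := Nat.card_le_card_of_surjective _ hi
  rw [card_latt hS] at this
  simpa using this

end four

lemma exists_Q {s : ℕ} (Γ : Submodule ℤ (Fin s → ℤ)) (n : ℤ) (hn : n ≠ 0)
    (h : ∀ w, n • w ∈ Γ) (hΓ : Γ ≠ ⊤) :
    ∃ Q : Matrix (Fin s) (Fin s) ℤ, 2 ≤ Q.det.natAbs ∧ ∀ w, w ∈ Γ ↔ ∃ c, w = Q.mulVec c := by
  have hr : Module.finrank ℤ Γ = s := by
    apply le_antisymm
    · simpa using Submodule.finrank_le Γ
    · let f : (Fin s → ℤ) →ₗ[ℤ] Γ := LinearMap.codRestrict Γ (n • LinearMap.id) (fun w => h w)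
      have hf : Function.Injective f := by
        intro a b hab
        have : n • a = n • b := congrArg Subtype.val hab
        exact smul_right_injective _ hn this
      simpa using LinearMap.finrank_le_finrank_of_injective hf
  let bN := Module.finBasisOfFinrankEq ℤ Γ hr
  let Q : Matrix (Fin s) (Fin s) ℤ := fun i j => (bN j : Fin s → ℤ) i
  have hQ : ∀ c, Q.mulVec c = ((∑ j, c j • bN j : Γ) : Fin s → ℤ) := by
    intro c
    ext i
    simp [mulVec, dotProduct, Q, mul_comm]
  have hmem : ∀ w, w ∈ Γ ↔ ∃ c, w = Q.mulVec c := by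
    intro w
    constructor
    · intro hw
      refine ⟨bN.repr ⟨w, hw⟩, ?_⟩
      rw [hQ, bN.sum_repr]
    · rintro ⟨c, rfl⟩
      rw [hQ]
      exact Subtype.property _
  refine ⟨Q, ?_, hmem⟩
  have h0 : Q.det ≠ 0 := by
    intro hd
    obtain ⟨v, hv, hv0⟩ := Matrix.exists_mulVec_eq_zero_iff.2 hd
    rw [hQ] at hv0
    have h1 : (∑ j, v j • bN j : Γ) = 0 := Subtype.ext hv0
    have := Fintype.linearIndependent_iff.1 bN.linearIndependent v h1
    exact hv (funext this)
  have h1 : Q.det.natAbs ≠ 1 := by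
    intro hd
    apply hΓ
    rw [eq_top_iff]
    intro w _
    rw [hmem]
    have hu : IsUnit Q.det := Int.isUnit_iff_natAbs_eq.2 hd
    exact ⟨Q⁻¹.mulVec w, by rw [mulVec_mulVec, mul_nonsing_inv _ hu, one_mulVec]⟩
  have : Q.det.natAbs ≠ 0 := by simpa using h0
  omega

section had
variable [Fintype ι] [DecidableEq ι]

lemma had_rows {S : Matrix ι ι ℤ} {B L : Finset (ι → ℤ)} (hB : B.card ≠ 0)
    (h : IsHadamardTriple S B L) :
    ∀ l ∈ L, ∀ l' ∈ L, ∑ b ∈ B, ee (pr S b (l - l')) = if l = l' then (B.card : ℂ) else 0 := by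
  rw [hadamard_iff] at h
  have hB' : (B.card : ℂ) ≠ 0 := by exact_mod_cast hB
  have := rows_of_cols B L h.1 (fun b l => ee (pr S b l)) (B.card : ℂ) hB' (by
    intro b hb b' hb'
    have h2 := h.2 b hb b' hb'
    rw [inv_mul_eq_iff_eq_mul₀ hB'] at h2
    simp only [ee_mul_conj, ← pr_sub_left]
    rw [h2]
    split_ifs <;> simp)
  simpa only [ee_mul_conj, ← pr_sub_right] using this

lemma had_of_rows {S : Matrix ι ι ℤ} {B L : Finset (ι → ℤ)} (hB : B.card ≠ 0)
    (hc : B.card = L.card)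
    (h : ∀ l ∈ L, ∀ l' ∈ L, ∑ b ∈ B, ee (pr S b (l - l')) = if l = l' then (B.card : ℂ) else 0) :
    IsHadamardTriple S B L := by
  rw [hadamard_iff]
  have hB' : (B.card : ℂ) ≠ 0 := by exact_mod_cast hB
  have := rows_of_cols L B hc.symm (fun l b => ee (pr S b l)) (B.card : ℂ) hB' (by
    intro l hl l' hl'
    simp only [ee_mul_conj, ← pr_sub_right]
    exact h l hl l' hl')
  refine ⟨hc, fun b hb b' hb' => ?_⟩
  have h2 := this b hb b' hb'
  simp only [ee_mul_conj, ← pr_sub_left] at h2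
  rw [h2]
  split_ifs <;> simp [hB']

lemma card_le_of_had_rows {S : Matrix ι ι ℤ} {B L : Finset (ι → ℤ)} (hB : B.card ≠ 0)
    (h : ∀ l ∈ L, ∀ l' ∈ L, ∑ b ∈ B, ee (pr S b (l - l')) = if l = l' then (B.card : ℂ) else 0) :
    L.card ≤ B.card := by
  refine card_le_of_rows B L (fun b l => ee (pr S b l)) (B.card : ℂ) (by exact_mod_cast hB) ?_
  simpa only [ee_mul_conj, ← pr_sub_right] using h

lemma had_inj {S : Matrix ι ι ℤ} (hS : S.det ≠ 0) {B L : Finset (ι → ℤ)} (hB : B.card ≠ 0)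
    (h : IsHadamardTriple S B L) : ∀ b ∈ B, ∀ b' ∈ B, b - b' ∈ latt S → b = b' := by
  intro b hb b' hb' hbb
  rw [hadamard_iff] at h
  have h2 := h.2 b hb b' hb'
  obtain ⟨k, hk⟩ := mem_latt.1 hbb
  simp only [hk, pr_mulVec_left hS, ee_int] at h2
  by_contra hne
  rw [if_neg hne] at h2
  have h3 : (B.card : ℂ) ≠ 0 := by exact_mod_cast hB
  have h4 : (L.card : ℂ) ≠ 0 := by rw [← h.1]; exact h3
  simp [h4] at h2
  exact hB (by simp [h2])

lemma had_shift {S : Matrix ι ι ℤ} (hS : S.det ≠ 0) {B L : Finset (ι → ℤ)} (hB : B.card ≠ 0)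
    (h : IsHadamardTriple S B L) (t : (ι → ℤ) → (ι → ℤ)) :
    IsHadamardTriple S B (L.image (fun l => l + Sᵀ.mulVec (t l))) := by
  have hrow := had_rows hB h
  have hper : ∀ b l, ee (pr S b (l + Sᵀ.mulVec (t l))) = ee (pr S b l) := by
    intro b l
    rw [pr_add_right, pr_mulVec_right hS, ee_add, ee_int, mul_one]
  have hinj : Set.InjOn (fun l => l + Sᵀ.mulVec (t l)) (L : Set (ι → ℤ)) := by
    intro l hl l' hl' hll
    have hll' : l + Sᵀ.mulVec (t l) = l' + Sᵀ.mulVec (t l') := hll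
    by_contra hne
    have h1 := hrow l hl l' hl'
    rw [if_neg hne] at h1
    have h2 : ∀ b, ee (pr S b (l - l')) = 1 := by
      intro b
      rw [pr_sub_right, ← ee_mul_conj, ← hper b l, hll', hper b l', ee_mul_conj, sub_self, ee_zero]
    simp only [h2] at h1
    simp at h1
    exact hB (by simp [h1])
  rw [hadamard_iff] at h ⊢
  refine ⟨by rw [Finset.card_image_of_injOn hinj]; exact h.1, fun b hb b' hb' => ?_⟩
  rw [Finset.sum_image hinj]
  simp only [hper]
  exact h.2 b hb b' hb'

end had

section blocks
variable {r s : ℕ}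

lemma sum_fib2 (B : Finset (Fin r ⊕ Fin s → ℤ)) (F : (Fin r ⊕ Fin s → ℤ) → ℂ) :
    ∑ b ∈ B, F b = ∑ p ∈ proj1Set B, ∑ q ∈ slice2 B p, F (Sum.elim p q) := by
  rw [← Finset.sum_fiberwise_of_maps_to (s := B) (t := proj1Set B) (g := proj1)
    (fun b hb => Finset.mem_image_of_mem _ hb)]
  refine Finset.sum_congr rfl fun p _ => ?_
  unfold slice2
  rw [Finset.sum_image]
  · refine Finset.sum_congr rfl fun b hb => ?_
    obtain ⟨_, rfl⟩ := Finset.mem_filter.1 hb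
    congr 1
    ext i; rcases i with i | i <;> rfl
  · intro a ha b hb hab
    have h1 := (Finset.mem_filter.1 ha).2.trans (Finset.mem_filter.1 hb).2.symm
    ext i; rcases i with i | i
    · exact congrFun h1 i
    · exact congrFun hab i

lemma sum_fib1 (B : Finset (Fin r ⊕ Fin s → ℤ)) (F : (Fin r ⊕ Fin s → ℤ) → ℂ) :
    ∑ b ∈ B, F b = ∑ q ∈ proj2Set B, ∑ p ∈ slice1 B q, F (Sum.elim p q) := by
  rw [← Finset.sum_fiberwise_of_maps_to (s := B) (t := proj2Set B) (g := proj2)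
    (fun b hb => Finset.mem_image_of_mem _ hb)]
  refine Finset.sum_congr rfl fun p _ => ?_
  unfold slice1
  rw [Finset.sum_image]
  · refine Finset.sum_congr rfl fun b hb => ?_
    obtain ⟨_, rfl⟩ := Finset.mem_filter.1 hb
    congr 1
    ext i; rcases i with i | i <;> rfl
  · intro a ha b hb hab
    have h1 := (Finset.mem_filter.1 ha).2.trans (Finset.mem_filter.1 hb).2.symm
    ext i; rcases i with i | i
    · exact congrFun hab i
    · exact congrFun h1 i

lemma mem_slice2 {B : Finset (Fin r ⊕ Fin s → ℤ)} {p : Fin r → ℤ} {q : Fin s → ℤ} :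
    q ∈ slice2 B p ↔ Sum.elim p q ∈ B := by
  unfold slice2
  simp only [Finset.mem_image, Finset.mem_filter]
  constructor
  · rintro ⟨a, ⟨ha, rfl⟩, rfl⟩
    have : Sum.elim (proj1 a) (proj2 a) = a := by ext i; rcases i with i | i <;> rfl
    rwa [this]
  · intro h
    exact ⟨_, ⟨h, rfl⟩, rfl⟩

lemma mem_slice1 {B : Finset (Fin r ⊕ Fin s → ℤ)} {p : Fin r → ℤ} {q : Fin s → ℤ} :
    p ∈ slice1 B q ↔ Sum.elim p q ∈ B := by
  unfold slice1
  simp only [Finset.mem_image, Finset.mem_filter]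
  constructor
  · rintro ⟨a, ⟨ha, rfl⟩, rfl⟩
    have : Sum.elim (proj1 a) (proj2 a) = a := by ext i; rcases i with i | i <;> rfl
    rwa [this]
  · intro h
    exact ⟨_, ⟨h, rfl⟩, rfl⟩

lemma imc_blocks (R₁ : Matrix (Fin r) (Fin r) ℤ) (R₂ : Matrix (Fin s) (Fin s) ℤ)
    (C : Matrix (Fin s) (Fin r) ℤ) :
    intMatCast (Matrix.fromBlocks R₁ 0 C R₂) =
      Matrix.fromBlocks (intMatCast R₁) 0 (C.map Int.cast) (intMatCast R₂) := by
  unfold intMatCast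
  rw [Matrix.fromBlocks_map]
  simp

lemma imcT_blocks (R₁ : Matrix (Fin r) (Fin r) ℤ) (R₂ : Matrix (Fin s) (Fin s) ℤ)
    (C : Matrix (Fin s) (Fin r) ℤ) :
    intMatCast (Matrix.fromBlocks R₁ 0 C R₂)ᵀ =
      Matrix.fromBlocks (intMatCast R₁ᵀ) (Cᵀ.map Int.cast) 0 (intMatCast R₂ᵀ) := by
  unfold intMatCast
  rw [Matrix.fromBlocks_transpose, Matrix.fromBlocks_map]
  simp

lemma ivc_elim (p : Fin r → ℤ) (q : Fin s → ℤ) :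
    intVecCast (Sum.elim p q) = Sum.elim (intVecCast p) (intVecCast q) := by
  ext i; rcases i with i | i <;> rfl

lemma pr_block2 {R₁ : Matrix (Fin r) (Fin r) ℤ} {R₂ : Matrix (Fin s) (Fin s) ℤ}
    {C : Matrix (Fin s) (Fin r) ℤ} (h : (Matrix.fromBlocks R₁ 0 C R₂).det ≠ 0)
    (h2 : R₂.det ≠ 0) (w : Fin s → ℤ) (p : Fin r → ℤ) (q : Fin s → ℤ) :
    pr (Matrix.fromBlocks R₁ 0 C R₂) (Sum.elim 0 w) (Sum.elim p q) = pr R₂ w q := by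
  have e : (intMatCast (Matrix.fromBlocks R₁ 0 C R₂)).mulVec
      (Sum.elim 0 ((intMatCast R₂)⁻¹.mulVec (intVecCast w))) = intVecCast (Sum.elim 0 w) := by
    rw [imc_blocks, Matrix.fromBlocks_mulVec, ivc_elim]
    congr 1
    · ext i; simp [intVecCast]
    · simp [imc_mul_inv h2]
  unfold pr
  rw [← e, imc_inv_mul h, ivc_elim]
  simp

lemma pr_block1 {R₁ : Matrix (Fin r) (Fin r) ℤ} {R₂ : Matrix (Fin s) (Fin s) ℤ}
    {C : Matrix (Fin s) (Fin r) ℤ} (h : (Matrix.fromBlocks R₁ 0 C R₂).det ≠ 0)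
    (h1 : R₁.det ≠ 0) (w : Fin r → ℤ) (p : Fin r → ℤ) (q : Fin s → ℤ) :
    pr (Matrix.fromBlocks R₁ 0 C R₂) (Sum.elim p q) (Sum.elim w 0) = pr R₁ p w := by
  have e : (intMatCast (Matrix.fromBlocks R₁ 0 C R₂)ᵀ).mulVec
      (Sum.elim ((intMatCast R₁ᵀ)⁻¹.mulVec (intVecCast w)) 0) = intVecCast (Sum.elim w 0) := by
    rw [imcT_blocks, Matrix.fromBlocks_mulVec, ivc_elim]
    congr 1
    · simp [imc_mul_inv (S := R₁ᵀ) (by rwa [det_transpose])]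
    · ext i; simp [intVecCast]
  rw [pr_eq_right, pr_eq_right, ← e, imc_inv_mul (by rwa [det_transpose]), ivc_elim]
  simp

end blocks

lemma fibre_zero {r s : ℕ} {R₁ : Matrix (Fin r) (Fin r) ℤ} {R₂ : Matrix (Fin s) (Fin s) ℤ}
    {C : Matrix (Fin s) (Fin r) ℤ} (dR : (Matrix.fromBlocks R₁ 0 C R₂).det ≠ 0)
    (dR₂ : R₂.det ≠ 0) (B : Finset (Fin r ⊕ Fin s → ℤ)) (m : ℕ) (y₀ : Fin s → ℝ)
    (htrans : ∀ 𝓛 : Finset (Fin r ⊕ Fin s → ℤ),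
      IsCompleteResidueSet (Matrix.fromBlocks R₁ 0 C R₂)ᵀ 𝓛 →
      ∀ k, 1 ≤ k → k ≤ m → ∀ z ∈ slabLevel r R₂ y₀ k, ∀ l ∈ 𝓛,
        0 < uB B ((intMatCast (Matrix.fromBlocks R₁ 0 C R₂)ᵀ)⁻¹.mulVec (z + intVecCast l)) →
        (intMatCast (Matrix.fromBlocks R₁ 0 C R₂)ᵀ)⁻¹.mulVec (z + intVecCast l)
          ∈ slabLevel r R₂ y₀ (k - 1)) :
    ∀ k < m, ∀ p ∈ proj1Set B, ∀ l, l ∉ latt R₂ᵀ →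
      ∑ b ∈ slice2 B p, ee (intVecCast b ⬝ᵥ ((intMatCast R₂ᵀ) ^ k).mulVec y₀) * ee (pr R₂ b l)
        = 0 := by
  intro k hk p hp l hl
  have dRT : (Matrix.fromBlocks R₁ 0 C R₂)ᵀ.det ≠ 0 := by rwa [det_transpose]
  have dR₂T : R₂ᵀ.det ≠ 0 := by rwa [det_transpose]
  obtain ⟨𝓛, h𝓛⟩ := exists_residues dRT
  obtain ⟨l₀, ⟨hl₀, _⟩, _⟩ := h𝓛 0
  refine char_indep (proj1Set B) (fun p => ∑ b ∈ slice2 B p,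
    ee (intVecCast b ⬝ᵥ ((intMatCast R₂ᵀ) ^ k).mulVec y₀) * ee (pr R₂ b l)) ?_ p hp
  intro x
  set yk := ((intMatCast R₂ᵀ) ^ k).mulVec y₀ with hyk
  set η := (intMatCast R₂ᵀ)⁻¹.mulVec (intVecCast l) with hη
  let w : Fin r ⊕ Fin s → ℝ := Sum.elim x (yk + η)
  have hw0 : ¬ 0 < uB B w := by
    intro hpos
    have hz : (intMatCast (Matrix.fromBlocks R₁ 0 C R₂)ᵀ).mulVec w - intVecCast l₀ ∈
        slabLevel r R₂ y₀ (k + 1) := by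
      refine ⟨Sum.elim (0 : Fin r → ℤ) l - l₀, ?_⟩
      rw [imcT_blocks, Matrix.fromBlocks_mulVec]
      have e1 : (intMatCast R₂ᵀ).mulVec (yk + η) =
          ((intMatCast R₂ᵀ) ^ (k + 1)).mulVec y₀ + intVecCast l := by
        rw [mulVec_add, hη, imc_mul_inv dR₂T, hyk, mulVec_mulVec, pow_succ']
      have e2 : w ∘ Sum.inr = yk + η := rfl
      rw [e2, e1]
      ext i
      simp [proj2, intVecCast]
    have hi := htrans 𝓛 h𝓛 (k + 1) (by omega) (by omega) _ hz l₀ hl₀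
    rw [sub_add_cancel, imc_inv_mul dRT] at hi
    obtain ⟨z, hz⟩ := hi hpos
    apply hl
    refine mem_latt.2 ⟨proj2 z, ?_⟩
    apply ivc_inj
    rw [ivc_mulVec]
    have e3 : intVecCast (proj2 z) = η := by
      ext i
      have := congrFun hz i
      simp only [proj2, Function.comp, Pi.sub_apply, w, Sum.elim_inr, Pi.add_apply,
        Nat.add_sub_cancel, ← hyk] at this
      have h4 : (intVecCast (proj2 z)) i = intVecCast z (Sum.inr i) := rfl
      rw [h4]
      linarith
    rw [e3, hη, imc_mul_inv dR₂T]
  have hs : ∑ b ∈ B, expv (intVecCast b) w = 0 := by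
    by_cases hB : B.card = 0
    · rw [Finset.card_eq_zero.1 hB]; simp
    · have h1 : uB B w = 0 := le_antisymm (not_lt.1 hw0) (by unfold uB; positivity)
      unfold uB at h1
      have h2 := norm_eq_zero.1 (pow_eq_zero_iff (two_ne_zero) |>.1 h1)
      rcases mul_eq_zero.1 h2 with h3 | h3
      · exact absurd h3 (by simpa using hB)
      · exact h3
  rw [sum_fib2] at hs
  rw [← hs]
  refine Finset.sum_congr rfl fun p _ => ?_
  rw [Finset.sum_mul]
  refine Finset.sum_congr rfl fun q _ => ?_
  rw [expv_eq, ivc_elim, pr_eq_right, ← hη]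
  have : Sum.elim (intVecCast p) (intVecCast q) ⬝ᵥ w =
      intVecCast p ⬝ᵥ x + (intVecCast q ⬝ᵥ yk + intVecCast q ⬝ᵥ η) := by
    simp only [w]
    rw [sumElim_dotProduct_sumElim, dotProduct_add]
  rw [this, ee_add, ee_add]
  ring

/-- If `𝒵 ≠ ∅` (via the invariant set `𝒮 ⊆ 𝒵`), the digit set `B` has a
quasi-product form, and after adjusting `L₀` modulo `Rᵀ(ℤ^d)` the components give
Hadamard triples in dimensions `r` and `d-r`. -/
theorem quasi_product_form {r s : ℕ}
    (R₁ : Matrix (Fin r) (Fin r) ℤ) (R₂ : Matrix (Fin s) (Fin s) ℤ)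
    (C : Matrix (Fin s) (Fin r) ℤ)
    (R : Matrix (Fin r ⊕ Fin s) (Fin r ⊕ Fin s) ℤ)
    (hRdef : R = Matrix.fromBlocks R₁ 0 C R₂)
    (hR : IsExpanding R) (hR₁ : IsExpanding R₁) (hR₂ : IsExpanding R₂)
    (B : Finset (Fin r ⊕ Fin s → ℤ))
    (μ : Measure (Fin r ⊕ Fin s → ℝ)) (hμ : IsSelfAffineMeasure R B μ)
    (m : ℕ) (hm : 1 ≤ m) (y₀ : Fin s → ℝ)
    (hy₀ : ∃ k : Fin s → ℤ, ((intMatCast R₂ᵀ) ^ m).mulVec y₀ - y₀ = intVecCast k)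
    (hSZ : (⋃ k ∈ Finset.range m, slabLevel r R₂ y₀ k) ⊆ Zset μ)
    (L₀ : Finset (Fin r ⊕ Fin s → ℤ))
    (hH : IsHadamardTriple R B L₀)
    (htrans : ∀ 𝓛 : Finset (Fin r ⊕ Fin s → ℤ), IsCompleteResidueSet Rᵀ 𝓛 →
      ∀ k, 1 ≤ k → k ≤ m → ∀ z ∈ slabLevel r R₂ y₀ k, ∀ l ∈ 𝓛,
        0 < uB B ((intMatCast Rᵀ)⁻¹.mulVec (z + intVecCast l)) →
        (intMatCast Rᵀ)⁻¹.mulVec (z + intVecCast l) ∈ slabLevel r R₂ y₀ (k - 1)) :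
    ∃ (N₁ : ℕ) (u : Fin N₁ → Fin r → ℤ) (v : Fin N₁ → Fin s → ℤ)
      (Q Rt₂ : Matrix (Fin s) (Fin s) ℤ)
      (c : Fin N₁ → Fin R₂.det.natAbs → Fin s → ℤ),
      N₁ * R₂.det.natAbs = B.card ∧
      B = Finset.image (fun p : Fin N₁ × Fin R₂.det.natAbs =>
            Sum.elim (u p.1) (v p.1 + Q.mulVec (c p.1 p.2))) Finset.univ ∧
      2 ≤ Q.det.natAbs ∧
      R₂ * Q = Q * Rt₂ ∧
      (∀ i : Fin N₁, ∀ w : Fin s → ℤ, ∃! j : Fin R₂.det.natAbs,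
        ∃ k : Fin s → ℤ, w - Q.mulVec (c i j) = R₂.mulVec k) ∧
      ∃ (t : (Fin r ⊕ Fin s → ℤ) → (Fin r ⊕ Fin s → ℤ))
        (L : Finset (Fin r ⊕ Fin s → ℤ)),
        L = L₀.image (fun l => l + Rᵀ.mulVec (t l)) ∧
        IsHadamardTriple R B L ∧
        (∀ l₂ ∈ proj2Set L, IsHadamardTriple R₁ (proj1Set B) (slice1 L l₂)) ∧
        (∀ b₁ ∈ proj1Set B, IsHadamardTriple R₂ (slice2 B b₁) (proj2Set L)) := by
  classical
  subst hRdef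
  have dR := det_ne_zero_of_expanding hR
  have dR₁ := det_ne_zero_of_expanding hR₁
  have dR₂ := det_ne_zero_of_expanding hR₂
  have dR₂T : R₂ᵀ.det ≠ 0 := by rwa [det_transpose]
  have hB : B.card ≠ 0 := by
    intro h0
    have hB0 : B = ∅ := Finset.card_eq_zero.1 h0
    have hp := hμ.1
    have := hμ.2.2 Set.univ MeasurableSet.univ
    rw [hB0] at this
    simp at this
  have hinjR := had_inj dR hB hH
  set D := R₂.det.natAbs with hD
  have hD0 : D ≠ 0 := by rw [hD]; simpa using dR₂
  let y : ℕ → Fin s → ℝ := fun k => ((intMatCast R₂ᵀ) ^ k).mulVec y₀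
  have hysucc : ∀ k, (intMatCast R₂ᵀ).mulVec (y k) = y (k + 1) := by
    intro k
    simp only [y]
    rw [mulVec_mulVec, pow_succ']
  have hfinj : ∀ p, ∀ b ∈ slice2 B p, ∀ b' ∈ slice2 B p, b - b' ∈ latt R₂ → b = b' := by
    intro p b hb b' hb' hbb
    rw [mem_slice2] at hb hb'
    obtain ⟨k, hk⟩ := mem_latt.1 hbb
    have := hinjR _ hb _ hb' (mem_latt.2 ⟨Sum.elim 0 k, by
      rw [Matrix.fromBlocks_mulVec]
      ext i; rcases i with i | i
      · simp
      · have := congrFun hk i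
        simpa using this⟩)
    funext i
    exact congrFun this (Sum.inr i)
  have hzero := fibre_zero dR dR₂ B m y₀ htrans
  have hne : ∀ p ∈ proj1Set B, (slice2 B p).Nonempty := by
    intro p hp
    obtain ⟨b, hb, rfl⟩ := Finset.mem_image.1 hp
    refine ⟨proj2 b, mem_slice2.2 ?_⟩
    have : Sum.elim (proj1 b) (proj2 b) = b := by ext i; rcases i with i | i <;> rfl
    rwa [this]
  have hfour : ∀ k < m, ∀ p ∈ proj1Set B, _ := fun k hk p hp =>
    fourier_fiber dR₂ (slice2 B p) (y k) (hne p hp) (hfinj p) (fun l hl => hzero k hk p hp l hl)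
  have hsur : ∀ p ∈ proj1Set B, ∀ a, ∃ b ∈ slice2 B p, a - b ∈ latt R₂ :=
    fun p hp => (hfour 0 (by omega) p hp).1
  have hcard : ∀ p ∈ proj1Set B, (slice2 B p).card = D :=
    fun p hp => card_eq_residues dR₂ _ (hfinj p) (hsur p hp)
  have hN : (proj1Set B).card * D = B.card := by
    have h1 := sum_fib2 B (fun _ => 1)
    simp only [Finset.sum_const, nsmul_eq_mul, mul_one] at h1
    have h2 : ∑ p ∈ proj1Set B, ((slice2 B p).card : ℂ) = ∑ p ∈ proj1Set B, (D : ℂ) :=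
      Finset.sum_congr rfl fun p hp => by rw [hcard p hp]
    rw [h2] at h1
    simp only [Finset.sum_const, nsmul_eq_mul] at h1
    exact_mod_cast h1.symm
  have hN10 : (proj1Set B).card ≠ 0 := by
    intro h; rw [h] at hN; omega
  obtain ⟨k₀, hk₀⟩ := hy₀
  have hk₀' : y m = y 0 + intVecCast k₀ := by
    simp only [y, pow_zero, one_mulVec]
    rw [← hk₀]; abel
  let Γ : Submodule ℤ (Fin s → ℤ) :=
    { carrier := {w | ∀ k < m, ∃ n : ℤ, intVecCast w ⬝ᵥ y k = n}
      zero_mem' := fun k _ => ⟨0, by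
        have : intVecCast (0 : Fin s → ℤ) = 0 := by ext i; simp [intVecCast]
        rw [this]; simp⟩
      add_mem' := by
        intro a b ha hb k hk
        obtain ⟨n, hn⟩ := ha k hk
        obtain ⟨n', hn'⟩ := hb k hk
        exact ⟨n + n', by rw [ivc_add, add_dotProduct, hn, hn']; push_cast; rfl⟩
      smul_mem' := by
        intro c a ha k hk
        obtain ⟨n, hn⟩ := ha k hk
        refine ⟨c * n, ?_⟩
        have : intVecCast (c • a) = (c : ℝ) • intVecCast a := by ext i; simp [intVecCast]
        rw [this, smul_dotProduct, hn]; simp }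
  have hΓmem : ∀ w, w ∈ Γ ↔ ∀ k < m, ∃ n : ℤ, intVecCast w ⬝ᵥ y k = n := fun w => Iff.rfl
  have hΓR : ∀ w ∈ Γ, R₂.mulVec w ∈ Γ := by
    intro w hw k hk
    have e : intVecCast (R₂.mulVec w) ⬝ᵥ y k = intVecCast w ⬝ᵥ y (k + 1) := by
      rw [← hysucc, ivc_mulVec, imc_transpose, mulVec_transpose, dotProduct_comm,
        dotProduct_mulVec, dotProduct_comm]
    rw [e]
    by_cases hk1 : k + 1 < m
    · exact hw _ hk1
    · have : k + 1 = m := by omega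
      rw [this, hk₀', dotProduct_add, ivc_dot]
      obtain ⟨n, hn⟩ := hw 0 (by omega)
      exact ⟨n + w ⬝ᵥ k₀, by rw [hn]; push_cast; rfl⟩
  have hy0int : ∀ z : Fin s → ℤ, y₀ ≠ intVecCast z := by
    intro z hz
    have h0 : (0 : Fin r ⊕ Fin s → ℝ) ∈ slabLevel r R₂ y₀ 0 := by
      refine ⟨Sum.elim 0 (-z), ?_⟩
      rw [pow_zero, one_mulVec, hz]
      ext i
      simp [proj2, intVecCast]
    have h1 := hSZ (Set.mem_biUnion (Finset.mem_coe.2 (Finset.mem_range.2 (by omega : 0 < m))) h0)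
    have h2 := h1 0
    have hp := hμ.1
    have e : (0 : Fin r ⊕ Fin s → ℝ) + intVecCast 0 = 0 := by ext i; simp [intVecCast]
    rw [e] at h2
    simp [ftMeasure, rdot] at h2
  have hΓtop : Γ ≠ ⊤ := by
    intro htop
    have h1 : ∀ i, ∃ n : ℤ, y₀ i = n := by
      intro i
      have h2 : (Pi.single i 1 : Fin s → ℤ) ∈ Γ := by rw [htop]; trivial
      obtain ⟨n, hn⟩ := h2 0 (by omega)
      have e1 : intVecCast (Pi.single i (1 : ℤ)) = Pi.single i (1 : ℝ) := by
        ext j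
        by_cases hj : j = i
        · subst hj; simp [intVecCast]
        · simp [intVecCast, hj]
      rw [e1, single_one_dotProduct] at hn
      refine ⟨n, ?_⟩
      simpa [y] using hn
    choose z hz using h1
    exact hy0int z (funext hz)
  have hfull : ∃ n : ℤ, n ≠ 0 ∧ ∀ w, n • w ∈ Γ := by
    have hM : IsExpanding R₂ᵀ := by
      intro z hz
      apply hR₂ z
      rw [spectrum.mem_iff, Matrix.isUnit_iff_isUnit_det] at hz ⊢
      rw [← det_transpose]
      convert hz using 3
      ext i j
      simp [Matrix.algebraMap_matrix_apply, eq_comm]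
    have hdet := det_pow_sub_one hM hm
    set M := R₂ᵀ ^ m - 1 with hMdef
    refine ⟨M.det, hdet, ?_⟩
    have hpow : ∀ k, intMatCast (R₂ᵀ ^ k) = (intMatCast R₂ᵀ) ^ k := by
      intro k
      exact map_pow ((Int.castRingHom ℝ).mapMatrix) R₂ᵀ k
    have hMy : (intMatCast M).mulVec y₀ = intVecCast k₀ := by
      have e : intMatCast M = (intMatCast R₂ᵀ) ^ m - 1 := by
        have := map_sub ((Int.castRingHom ℝ).mapMatrix) (R₂ᵀ ^ m) 1
        rw [map_one, map_pow] at this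
        exact this
      rw [e, sub_mulVec, one_mulVec, hk₀]
    have hdy : (M.det : ℝ) • y₀ = intVecCast (M.adjugate.mulVec k₀) := by
      have e : intMatCast M.adjugate = (intMatCast M).adjugate :=
        RingHom.map_adjugate (Int.castRingHom ℝ) M
      rw [ivc_mulVec, ← hMy, mulVec_mulVec, e, adjugate_mul, imc_det, smul_mulVec, one_mulVec]
    intro w k hk
    refine ⟨w ⬝ᵥ ((R₂ᵀ ^ k).mulVec (M.adjugate.mulVec k₀)), ?_⟩
    have e2 : intVecCast (M.det • w) = (M.det : ℝ) • intVecCast w := by ext i; simp [intVecCast]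
    rw [e2, smul_dotProduct, ← dotProduct_smul, ← ivc_dot, ivc_mulVec, ← hdy, mulVec_smul, hpow]
  obtain ⟨n, hn0, hn⟩ := hfull
  obtain ⟨Q, hQ2, hQ⟩ := exists_Q Γ n hn0 hn hΓtop
  have hRt : ∃ Rt₂ : Matrix (Fin s) (Fin s) ℤ, R₂ * Q = Q * Rt₂ := by
    have h1 : ∀ j, ∃ c, R₂.mulVec (Q.col j) = Q.mulVec c := by
      intro j
      rw [← hQ]
      apply hΓR
      rw [hQ]
      exact ⟨Pi.single j 1, by rw [mulVec_single_one]⟩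
    choose c hc using h1
    refine ⟨fun i j => c j i, ?_⟩
    ext i j
    exact congrFun (hc j) i
  obtain ⟨Rt₂, hRt⟩ := hRt
  let e₁ : Fin (proj1Set B).card ≃ proj1Set B := (proj1Set B).equivFin.symm
  have hvex : ∀ i, ∃ q, q ∈ slice2 B (e₁ i) := fun i => hne _ (e₁ i).2
  choose v hv using hvex
  have e₂ : ∀ i, Nonempty (Fin D ≃ slice2 B (e₁ i)) := fun i =>
    ⟨((slice2 B (e₁ i)).equivFinOfCardEq (hcard _ (e₁ i).2)).symm⟩
  let e₂' := fun i => Classical.choice (e₂ i)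
  have hcex : ∀ i j, ∃ c, ((e₂' i j : Fin s → ℤ) - v i) = Q.mulVec c := by
    intro i j
    rw [← hQ]
    intro k hk
    exact (hfour k hk _ (e₁ i).2).2 _ (e₂' i j).2 _ (hv i)
  choose c hc using hcex
  have hvc : ∀ i j, v i + Q.mulVec (c i j) = e₂' i j := by
    intro i j; rw [← hc]; abel
  refine ⟨(proj1Set B).card, fun i => e₁ i, v, Q, Rt₂, c, hN, ?_, hQ2, hRt, ?_, ?_⟩
  · ext b
    simp only [Finset.mem_image, Finset.mem_univ, true_and, hvc]
    constructor
    · intro hb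
      have hb' : Sum.elim (proj1 b) (proj2 b) = b := by ext i; rcases i with i | i <;> rfl
      obtain ⟨i, hi⟩ := e₁.surjective ⟨proj1 b, Finset.mem_image_of_mem _ hb⟩
      have hi' : (e₁ i : Fin r → ℤ) = proj1 b := by rw [hi]
      obtain ⟨j, hj⟩ := (e₂' i).surjective ⟨proj2 b, mem_slice2.2 (by rw [hi', hb']; exact hb)⟩
      refine ⟨(i, j), ?_⟩
      simp only [hj, hi', hb']
    · rintro ⟨⟨i, j⟩, rfl⟩
      exact mem_slice2.1 (e₂' i j).2
  · intro i w
    obtain ⟨b, hb, hwb⟩ := hsur _ (e₁ i).2 (w + v i)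
    obtain ⟨j, hj⟩ := (e₂' i).surjective ⟨b, hb⟩
    have hrel : ∀ j, w - Q.mulVec (c i j) = w + v i - (e₂' i j : Fin s → ℤ) := by
      intro j; rw [← hvc]; abel
    refine ⟨j, ?_, ?_⟩
    · simp only [hrel]
      rw [← mem_latt, hj]
      exact hwb
    · intro j' hj'
      simp only [hrel] at hj'
      rw [← mem_latt] at hj'
      apply (e₂' i).injective
      apply Subtype.ext
      apply hfinj _ _ (e₂' i j').2 _ (e₂' i j).2
      have := (latt R₂).sub_mem hwb hj'
      rw [hj]
      convert this using 1
      simp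
  have htex : ∀ l : Fin s → ℤ, ∃ t, Quotient.out (Submodule.Quotient.mk l : (Fin s → ℤ) ⧸ latt R₂ᵀ)
      = l + R₂ᵀ.mulVec t := by
    intro l
    have : Quotient.out (Submodule.Quotient.mk l : (Fin s → ℤ) ⧸ latt R₂ᵀ) - l ∈ latt R₂ᵀ := by
      rw [← Submodule.Quotient.eq]
      exact Quotient.out_eq _
    obtain ⟨t, ht⟩ := mem_latt.1 this
    exact ⟨t, by rw [← ht]; abel⟩
  choose t₂ ht₂ using htex
  set R := Matrix.fromBlocks R₁ 0 C R₂ with hRd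
  let t : (Fin r ⊕ Fin s → ℤ) → (Fin r ⊕ Fin s → ℤ) := fun l => Sum.elim 0 (t₂ (proj2 l))
  set L := L₀.image (fun l => l + Rᵀ.mulVec (t l)) with hL
  have hHL : IsHadamardTriple R B L := had_shift dR hB hH t
  have hrow := had_rows hB hHL
  have hproj : ∀ l, proj2 (l + Rᵀ.mulVec (t l)) =
      Quotient.out (Submodule.Quotient.mk (proj2 l) : (Fin s → ℤ) ⧸ latt R₂ᵀ) := by
    intro l
    rw [ht₂, hRd, Matrix.fromBlocks_transpose, Matrix.fromBlocks_mulVec]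
    ext i
    simp [proj2, t]
  have hL2mem : ∀ q ∈ proj2Set L, ∃ x : (Fin s → ℤ) ⧸ latt R₂ᵀ, q = Quotient.out x := by
    intro q hq
    obtain ⟨l, hl, rfl⟩ := Finset.mem_image.1 hq
    obtain ⟨l', hl', rfl⟩ := Finset.mem_image.1 hl
    exact ⟨_, hproj l'⟩
  have hL2card : (proj2Set L).card ≤ D := by
    have := card_le_residues dR₂T (proj2Set L) (by
      intro a ha b hb hab
      obtain ⟨x, rfl⟩ := hL2mem a ha
      obtain ⟨x', rfl⟩ := hL2mem b hb
      rw [← Submodule.Quotient.eq] at hab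
      have h1 : x = x' := (Quotient.out_eq x).symm.trans (hab.trans (Quotient.out_eq x'))
      rw [h1])
    rwa [det_transpose] at this
  have hDC : (D : ℂ) ≠ 0 := by exact_mod_cast hD0
  have hrow1 : ∀ q ∈ proj2Set L, ∀ l ∈ slice1 L q, ∀ l' ∈ slice1 L q,
      ∑ p ∈ proj1Set B, ee (pr R₁ p (l - l')) = if l = l' then ((proj1Set B).card : ℂ) else 0 := by
    intro q _ l hl l' hl'
    have h1 := hrow _ (mem_slice1.1 hl) _ (mem_slice1.1 hl')
    have e : (Sum.elim l q - Sum.elim l' q : Fin r ⊕ Fin s → ℤ) = Sum.elim (l - l') 0 := by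
      ext i; rcases i with i | i <;> simp
    rw [e, sum_fib2] at h1
    have h2 : ∀ p ∈ proj1Set B, ∑ q ∈ slice2 B p, ee (pr R (Sum.elim p q) (Sum.elim (l - l') 0)) =
        D * ee (pr R₁ p (l - l')) := by
      intro p hp
      simp only [hRd, pr_block1 dR dR₁]
      rw [Finset.sum_const, hcard p hp, nsmul_eq_mul]
    rw [Finset.sum_congr rfl h2, ← Finset.mul_sum] at h1
    apply mul_left_cancel₀ hDC
    rw [h1, ← hN]
    have e3 : (Sum.elim l q = (Sum.elim l' q : Fin r ⊕ Fin s → ℤ)) ↔ l = l' := by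
      constructor
      · intro h; funext i; exact congrFun h (Sum.inl i)
      · rintro rfl; rfl
    simp only [e3]
    split_ifs
    · push_cast; ring
    · simp
  have hle : ∀ q ∈ proj2Set L, (slice1 L q).card ≤ (proj1Set B).card :=
    fun q hq => card_le_of_had_rows hN10 (hrow1 q hq)
  have hsum : ∑ q ∈ proj2Set L, (slice1 L q).card = B.card := by
    have h1 := sum_fib1 L (fun _ => 1)
    simp only [Finset.sum_const, nsmul_eq_mul, mul_one] at h1
    rw [← hHL.1] at h1
    exact_mod_cast h1.symm
  have hup : ∑ q ∈ proj2Set L, (proj1Set B).card ≤ B.card := by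
    rw [Finset.sum_const, smul_eq_mul, ← hN, mul_comm]
    exact Nat.mul_le_mul_left _ hL2card
  have hsum2 : ∑ q ∈ proj2Set L, (slice1 L q).card = ∑ q ∈ proj2Set L, (proj1Set B).card :=
    le_antisymm (Finset.sum_le_sum hle) (by rw [hsum]; exact hup)
  have heq : ∀ q ∈ proj2Set L, (slice1 L q).card = (proj1Set B).card :=
    (Finset.sum_eq_sum_iff_of_le hle).1 hsum2
  have hL2eq : (proj2Set L).card = D := by
    rw [hsum, Finset.sum_const, smul_eq_mul, ← hN, mul_comm] at hsum2
    exact (Nat.eq_of_mul_eq_mul_right (Nat.pos_of_ne_zero hN10) hsum2).symm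
  refine ⟨t, L, rfl, hHL, ?_, ?_⟩
  · intro q hq
    exact had_of_rows hN10 (heq q hq).symm (hrow1 q hq)
  · intro p hp
    rw [hadamard_iff]
    refine ⟨by rw [hcard p hp, hL2eq], fun b hb b' hb' => ?_⟩
    rw [hcard p hp]
    have h1 := (hadamard_iff.1 hHL).2 _ (mem_slice2.1 hb) _ (mem_slice2.1 hb')
    have e : (Sum.elim p b - Sum.elim p b' : Fin r ⊕ Fin s → ℤ) = Sum.elim (0 : Fin r → ℤ) (b - b') := by
      ext i; rcases i with i | i <;> simp
    rw [e, sum_fib1] at h1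
    have h2 : ∀ q ∈ proj2Set L, ∑ l ∈ slice1 L q, ee (pr R (Sum.elim 0 (b - b')) (Sum.elim l q)) =
        (proj1Set B).card * ee (pr R₂ (b - b') q) := by
      intro q hq
      simp only [hRd, pr_block2 dR dR₂]
      rw [Finset.sum_const, heq q hq, nsmul_eq_mul]
    rw [Finset.sum_congr rfl h2, ← Finset.mul_sum, ← hN] at h1
    have e3 : (Sum.elim p b = (Sum.elim p b' : Fin r ⊕ Fin s → ℤ)) ↔ b = b' := by
      constructor
      · intro h; funext i; exact congrFun h (Sum.inr i)
      · rintro rfl; rfl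
    simp only [e3] at h1
    rw [← h1]
    have hN1C : ((proj1Set B).card : ℂ) ≠ 0 := by exact_mod_cast hN10
    push_cast
    field_simp

end
end

section
/- Let R = [[R₁,0],[C,R₂]] be a d×d expanding integer matrix in block lower-triangular form with R₁ ∈ M_r(ℤ) and R₂ ∈ M_{d−r}(ℤ), let (R,B,L) be a Hadamard triple, and let 𝓛 ⊇ L be a complete set of representatives (mod Rᵀ(ℤ^d)). Then there exist a set L' ⊂ ℤ^d with L' ≡ L (mod Rᵀ(ℤ^d)) and a complete set of representatives 𝓛' (mod Rᵀ(ℤ^d)) such that (R,B,L') is a Hadamard triple and both L' and 𝓛' satisfy: whenever ℓ, ℓ' belong to the set and π₂(ℓ) ≡ π₂(ℓ') (mod R₂ᵀ(ℤ^{d−r})), then π₂(ℓ) = π₂(ℓ'). -/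
open MeasureTheory Matrix Filter
open scoped BigOperators Classical

noncomputable section

variable {ι : Type*}

theorem isUnit_det_of_isExpanding {ι : Type*} [Fintype ι] [DecidableEq ι] (R : Matrix ι ι ℤ)
    (hR : IsExpanding R) : IsUnit (intMatCast R).det := by
  have h0 : (0 : ℂ) ∉ spectrum ℂ (R.map (Int.cast : ℤ → ℂ)) := by
    intro h
    have := hR 0 h
    simp at this
    linarith
  have h1 : IsUnit (R.map (Int.cast : ℤ → ℂ)) := by
    by_contra h
    exact h0 ((spectrum.zero_mem_iff ℂ).2 h)
  rw [Matrix.isUnit_iff_isUnit_det] at h1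
  have h2 : (R.map (Int.cast : ℤ → ℂ)).det = (R.det : ℂ) :=
    ((Int.castRingHom ℂ).map_det R).symm
  have h3 : (intMatCast R).det = (R.det : ℝ) :=
    ((Int.castRingHom ℝ).map_det R).symm
  rw [h2] at h1
  rw [h3]
  have h4 : R.det ≠ 0 := by
    intro h
    simp [h] at h1
  exact isUnit_iff_ne_zero.2 (by exact_mod_cast h4)

theorem expv_add_transpose {ι : Type*} [Fintype ι] [DecidableEq ι] (R : Matrix ι ι ℤ)
    (hR : IsUnit (intMatCast R).det) (b l k : ι → ℤ) :
    expv ((intMatCast R)⁻¹.mulVec (intVecCast b)) (intVecCast (l + Rᵀ.mulVec k)) =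
      expv ((intMatCast R)⁻¹.mulVec (intVecCast b)) (intVecCast l) := by
  have hcast : intVecCast (l + Rᵀ.mulVec k) =
      intVecCast l + (intMatCast R)ᵀ.mulVec (intVecCast k) := by
    funext i
    simp [intVecCast, intMatCast, Matrix.mulVec, dotProduct]
  have hd : rdot ((intMatCast R)⁻¹.mulVec (intVecCast b)) (intVecCast (l + Rᵀ.mulVec k)) =
      rdot ((intMatCast R)⁻¹.mulVec (intVecCast b)) (intVecCast l) + ((b ⬝ᵥ k : ℤ) : ℝ) := by
    rw [hcast]
    change _ ⬝ᵥ (_ + _) = _ ⬝ᵥ _ + _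
    rw [dotProduct_add]
    congr 1
    rw [Matrix.mulVec_transpose, dotProduct_comm, ← Matrix.dotProduct_mulVec,
      Matrix.mulVec_mulVec, Matrix.mul_nonsing_inv _ hR, Matrix.one_mulVec, dotProduct_comm]
    simp [dotProduct, intVecCast]
  unfold expv
  rw [hd]
  apply Complex.exp_eq_exp_iff_exists_int.2
  refine ⟨b ⬝ᵥ k, ?_⟩
  push_cast
  ring

/-- One can modify `L` and find a complete residue system `𝓛'` so that the
Hadamard property is preserved and `π₂` is injective modulo `R₂ᵀ(ℤ^{d-r})`. -/
theorem exists_representatives_pi2_injective {r s : ℕ}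
    (R₁ : Matrix (Fin r) (Fin r) ℤ) (R₂ : Matrix (Fin s) (Fin s) ℤ)
    (C : Matrix (Fin s) (Fin r) ℤ)
    (R : Matrix (Fin r ⊕ Fin s) (Fin r ⊕ Fin s) ℤ)
    (hRdef : R = Matrix.fromBlocks R₁ 0 C R₂)
    (hR : IsExpanding R)
    (B L 𝓛 : Finset (Fin r ⊕ Fin s → ℤ))
    (hH : IsHadamardTriple R B L)
    (hL𝓛 : L ⊆ 𝓛) (h𝓛 : IsCompleteResidueSet Rᵀ 𝓛) :
    ∃ (t : (Fin r ⊕ Fin s → ℤ) → (Fin r ⊕ Fin s → ℤ))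
      (L' 𝓛' : Finset (Fin r ⊕ Fin s → ℤ)),
      L' = L.image (fun l => l + Rᵀ.mulVec (t l)) ∧
      IsCompleteResidueSet Rᵀ 𝓛' ∧
      IsHadamardTriple R B L' ∧
      (∀ l ∈ L', ∀ l' ∈ L',
        (∃ k : Fin s → ℤ, proj2 l - proj2 l' = R₂ᵀ.mulVec k) → proj2 l = proj2 l') ∧
      (∀ l ∈ 𝓛', ∀ l' ∈ 𝓛',
        (∃ k : Fin s → ℤ, proj2 l - proj2 l' = R₂ᵀ.mulVec k) → proj2 l = proj2 l') := by
  have hdet := isUnit_det_of_isExpanding R hR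
  let G : AddSubgroup (Fin s → ℤ) := (R₂ᵀ.mulVecLin.toAddMonoidHom).range
  have hG : ∀ v, v ∈ G ↔ ∃ k, R₂ᵀ.mulVec k = v := fun v => Iff.rfl
  let ρ : (Fin s → ℤ) → (Fin s → ℤ) := fun y => Quotient.out (QuotientAddGroup.mk y : _ ⧸ G)
  have hρ : ∀ y, ∃ k, R₂ᵀ.mulVec k = -y + ρ y := by
    intro y
    rw [← hG, ← QuotientAddGroup.eq]
    exact (Quotient.out_eq' _).symm
  choose κ hκ using hρ
  have hρc : ∀ y y' k, y - y' = R₂ᵀ.mulVec k → ρ y = ρ y' := by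
    intro y y' k h
    have : (QuotientAddGroup.mk y : _ ⧸ G) = QuotientAddGroup.mk y' := by
      rw [QuotientAddGroup.eq, hG]
      refine ⟨-k, ?_⟩
      rw [Matrix.mulVec_neg, ← h]
      abel
    exact congrArg Quotient.out this
  let t : (Fin r ⊕ Fin s → ℤ) → (Fin r ⊕ Fin s → ℤ) := fun l => Sum.elim 0 (κ (proj2 l))
  let f : (Fin r ⊕ Fin s → ℤ) → (Fin r ⊕ Fin s → ℤ) := fun l => l + Rᵀ.mulVec (t l)
  have hp2 : ∀ l, proj2 (f l) = ρ (proj2 l) := by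
    intro l
    have h1 : proj2 (Rᵀ.mulVec (t l)) = R₂ᵀ.mulVec (κ (proj2 l)) := by
      rw [hRdef, Matrix.fromBlocks_transpose, Matrix.fromBlocks_mulVec]
      funext i
      simp [proj2, t]
    have h2 : proj2 (f l) = proj2 l + proj2 (Rᵀ.mulVec (t l)) := rfl
    rw [h2, h1, hκ]
    abel
  have hf : ∀ l, l = f l - Rᵀ.mulVec (t l) := by
    intro l
    simp [f]
  have huniq : ∀ l ∈ 𝓛, ∀ l' ∈ 𝓛, (∃ k, l - l' = Rᵀ.mulVec k) → l = l' := by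
    intro l hl l' hl' hk
    exact (h𝓛 l).unique ⟨hl, 0, by simp⟩ ⟨hl', hk⟩
  have hinj : Set.InjOn f (𝓛 : Set (Fin r ⊕ Fin s → ℤ)) := by
    intro l hl l' hl' h
    refine huniq l hl l' hl' ⟨t l' - t l, ?_⟩
    rw [Matrix.mulVec_sub]
    have h3 : l + Rᵀ.mulVec (t l) = l' + Rᵀ.mulVec (t l') := h
    rw [sub_eq_sub_iff_add_eq_add, h3]
    abel
  have hinjL : Set.InjOn f (L : Set (Fin r ⊕ Fin s → ℤ)) :=
    hinj.mono (by exact_mod_cast hL𝓛)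
  have hsep : ∀ A : Finset (Fin r ⊕ Fin s → ℤ), ∀ l ∈ A.image f, ∀ l' ∈ A.image f,
      (∃ k : Fin s → ℤ, proj2 l - proj2 l' = R₂ᵀ.mulVec k) → proj2 l = proj2 l' := by
    intro A l hl l' hl' hk
    obtain ⟨a, -, rfl⟩ := Finset.mem_image.1 hl
    obtain ⟨a', -, rfl⟩ := Finset.mem_image.1 hl'
    obtain ⟨k, hk⟩ := hk
    rw [hp2, hp2] at hk ⊢
    refine hρc _ _ (k - κ (proj2 a) + κ (proj2 a')) ?_
    rw [Matrix.mulVec_add, Matrix.mulVec_sub, hκ, hκ, ← hk]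
    abel
  refine ⟨t, L.image f, 𝓛.image f, rfl, ?_, ⟨?_, ?_⟩, hsep L, hsep 𝓛⟩
  · intro v
    obtain ⟨l, ⟨hl, k, hk⟩, hu⟩ := h𝓛 v
    refine ⟨f l, ⟨Finset.mem_image_of_mem f hl, k - t l, ?_⟩, ?_⟩
    · rw [Matrix.mulVec_sub, ← hk]
      simp only [f]
      abel
    · rintro m ⟨hm, k', hk'⟩
      obtain ⟨a, ha, rfl⟩ := Finset.mem_image.1 hm
      have : a = l := by
        refine hu a ⟨ha, k' + t a, ?_⟩
        rw [Matrix.mulVec_add, ← hk']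
        simp only [f]
        abel
      rw [this]
  · rw [Finset.card_image_of_injOn hinjL]
    exact hH.1
  · intro b hb b' hb'
    rw [Finset.sum_image hinjL, ← hH.2 b hb b' hb']
    congr 1
    refine Finset.sum_congr rfl fun l _ => ?_
    simp only [f]
    rw [expv_add_transpose R hdet, expv_add_transpose R hdet]

end
end

section
/- Let R = [[R₁,0],[C,R₂]] be a d×d expanding integer matrix in block lower-triangular form with R₁ ∈ M_r(ℤ) and R₂ ∈ M_{d−r}(ℤ), and let (R,B,L) be a Hadamard triple. Then for every b₁ ∈ π₁(B) and every pair b₂ ≠ b₂' in B₂(b₁), one has Σ_{ℓ₂ ∈ π₂(L)} #L₁(ℓ₂) · e^{2πi⟨R₂⁻¹(b₂−b₂'), ℓ₂⟩} = 0. Moreover, for every b₁ ∈ π₁(B), #B₂(b₁) ≤ #π₂(L) and distinct elements of B₂(b₁) are not congruent modulo R₂(ℤ^{d−r}). -/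
open MeasureTheory Matrix Filter
open scoped BigOperators Classical

noncomputable section

variable {ι : Type*}

theorem expv_mul_conj {ι : Type*} [Fintype ι] (x x' y : ι → ℝ) :
    expv x y * (starRingEnd ℂ) (expv x' y) = expv (x - x') y := by
  unfold expv
  rw [← Complex.exp_conj, ← Complex.exp_add]
  congr 1
  simp only [map_mul, Complex.conj_ofReal, Complex.conj_I, map_ofNat]
  have : rdot (x - x') y = rdot x y - rdot x' y := by
    simp [rdot, sub_mul, Finset.sum_sub_distrib]
  rw [this]; push_cast; ring

theorem intVecCast_sub {ι : Type*} (x y : ι → ℤ) :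
    intVecCast (x - y) = intVecCast x - intVecCast y := by
  ext i; simp [intVecCast]

theorem expv_int {ι : Type*} [Fintype ι] (x y : ι → ℤ) :
    expv (intVecCast x) (intVecCast y) = 1 := by
  unfold expv
  rw [Complex.exp_eq_one_iff]
  refine ⟨∑ i, x i * y i, ?_⟩
  simp only [rdot, intVecCast]; push_cast; ring

theorem intMatCast_mulVec {ι : Type*} [Fintype ι] [DecidableEq ι] (R : Matrix ι ι ℤ) (k : ι → ℤ) :
    intVecCast (R.mulVec k) = (intMatCast R).mulVec (intVecCast k) := by
  ext i; simp [intVecCast, intMatCast, Matrix.mulVec, dotProduct]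

theorem expanding_det {ι : Type*} [Fintype ι] [DecidableEq ι] (R : Matrix ι ι ℤ)
    (hR : IsExpanding R) : R.det ≠ 0 := by
  intro h
  have := hR 0 (by
    rw [spectrum.zero_mem_iff, Matrix.isUnit_iff_isUnit_det]
    have : (R.map (Int.cast : ℤ → ℂ)).det = ((R.det : ℤ) : ℂ) := by
      have := (Int.castRingHom ℂ).map_det R
      simpa [RingHom.mapMatrix_apply] using this.symm
    rw [this, h]; simp)
  simp at this
  linarith

theorem intMatCast_det {ι : Type*} [Fintype ι] [DecidableEq ι] (R : Matrix ι ι ℤ)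
    (h : R.det ≠ 0) : IsUnit (intMatCast R).det := by
  have : (intMatCast R).det = ((R.det : ℤ) : ℝ) := by
    have := (Int.castRingHom ℝ).map_det R
    simpa [RingHom.mapMatrix_apply, intMatCast] using this.symm
  rw [this, isUnit_iff_ne_zero]; exact_mod_cast h

theorem proj_ext {r s : ℕ} {α : Type*} {a b : Fin r ⊕ Fin s → α} (h1 : proj1 a = proj1 b)
    (h2 : proj2 a = proj2 b) : a = b := by
  ext (i | i)
  · exact congrFun h1 i
  · exact congrFun h2 i

/-- Block inverse applied to a vector supported on the second block. -/
theorem block_inv {r s : ℕ}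
    (R₁ : Matrix (Fin r) (Fin r) ℤ) (R₂ : Matrix (Fin s) (Fin s) ℤ)
    (C : Matrix (Fin s) (Fin r) ℤ)
    (R : Matrix (Fin r ⊕ Fin s) (Fin r ⊕ Fin s) ℤ)
    (hRdef : R = Matrix.fromBlocks R₁ 0 C R₂) (hd : R.det ≠ 0) (hd2 : R₂.det ≠ 0)
    (v : Fin r ⊕ Fin s → ℤ) (hv : proj1 v = 0) :
    (intMatCast R)⁻¹.mulVec (intVecCast v) =
      Sum.elim (0 : Fin r → ℝ) ((intMatCast R₂)⁻¹.mulVec (intVecCast (proj2 v))) := by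
  have hu := intMatCast_det R hd
  have hu2 := intMatCast_det R₂ hd2
  have hc : intMatCast R = Matrix.fromBlocks (intMatCast R₁) 0 (C.map (Int.cast : ℤ → ℝ))
      (intMatCast R₂) := by
    rw [hRdef]; unfold intMatCast; rw [Matrix.fromBlocks_map]; simp
  have key : (intMatCast R).mulVec
      (Sum.elim (0 : Fin r → ℝ) ((intMatCast R₂)⁻¹.mulVec (intVecCast (proj2 v)))) = intVecCast v := by
    rw [hc, Matrix.fromBlocks_mulVec]
    simp only [Sum.elim_comp_inl, Sum.elim_comp_inr, Matrix.mulVec_zero, Matrix.zero_mulVec,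
      Matrix.mulVec_mulVec, Matrix.mul_nonsing_inv _ hu2, Matrix.one_mulVec, zero_add]
    ext (i | i)
    · have := congrFun hv i
      simp only [proj1, Function.comp_apply, Pi.zero_apply] at this
      simp [intVecCast, this]
    · simp [intVecCast, proj2]
  rw [← key, Matrix.mulVec_mulVec, Matrix.nonsing_inv_mul _ hu, Matrix.one_mulVec]

theorem slice1_card {r s : ℕ} (L : Finset (Fin r ⊕ Fin s → ℤ)) (l₂ : Fin s → ℤ) :
    (slice1 L l₂).card = (L.filter (fun a => proj2 a = l₂)).card := by
  unfold slice1
  apply Finset.card_image_of_injOn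
  intro a ha b hb hab
  simp only [Finset.coe_filter, Set.mem_setOf_eq] at ha hb
  exact proj_ext hab (ha.2.trans hb.2.symm)

theorem sum_proj2 {r s : ℕ} (L : Finset (Fin r ⊕ Fin s → ℤ)) (f : (Fin s → ℤ) → ℂ) :
    ∑ l₂ ∈ proj2Set L, ((slice1 L l₂).card : ℂ) * f l₂ = ∑ l ∈ L, f (proj2 l) := by
  rw [← Finset.sum_fiberwise_of_maps_to (s := L) (t := proj2Set L) (g := proj2)
    (fun l hl => Finset.mem_image_of_mem _ hl)]
  refine Finset.sum_congr rfl fun l₂ _ => ?_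
  rw [slice1_card, Finset.sum_congr rfl (g := fun _ => f l₂), Finset.sum_const, nsmul_eq_mul]
  intro x hx
  rw [(Finset.mem_filter.1 hx).2]

theorem mem_slice2_s11 {r s : ℕ} {B : Finset (Fin r ⊕ Fin s → ℤ)} {b₁ : Fin r → ℤ} {b₂ : Fin s → ℤ}
    (h : b₂ ∈ slice2 B b₁) : ∃ b ∈ B, proj1 b = b₁ ∧ proj2 b = b₂ := by
  obtain ⟨b, hb, rfl⟩ := Finset.mem_image.1 h
  exact ⟨b, (Finset.mem_filter.1 hb).1, (Finset.mem_filter.1 hb).2, rfl⟩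

/-- Orthogonality relations for the second components of the digit set. -/
theorem second_component_orthogonality {r s : ℕ}
    (R₁ : Matrix (Fin r) (Fin r) ℤ) (R₂ : Matrix (Fin s) (Fin s) ℤ)
    (C : Matrix (Fin s) (Fin r) ℤ)
    (R : Matrix (Fin r ⊕ Fin s) (Fin r ⊕ Fin s) ℤ)
    (hRdef : R = Matrix.fromBlocks R₁ 0 C R₂)
    (hR : IsExpanding R)
    (B L : Finset (Fin r ⊕ Fin s → ℤ))
    (hH : IsHadamardTriple R B L) :
    (∀ b₁ ∈ proj1Set B, ∀ b₂ ∈ slice2 B b₁, ∀ b₂' ∈ slice2 B b₁, b₂ ≠ b₂' →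
      (∑ l₂ ∈ proj2Set L, ((slice1 L l₂).card : ℂ) *
          expv ((intMatCast R₂)⁻¹.mulVec (intVecCast (b₂ - b₂'))) (intVecCast l₂)) = 0) ∧
    (∀ b₁ ∈ proj1Set B,
      (slice2 B b₁).card ≤ (proj2Set L).card ∧
      (∀ c₂ ∈ slice2 B b₁, ∀ c₂' ∈ slice2 B b₁,
        (∃ k : Fin s → ℤ, c₂ - c₂' = R₂.mulVec k) → c₂ = c₂')) := by
  have hd := expanding_det R hR
  have hd2 : R₂.det ≠ 0 := by
    intro h
    apply hd
    rw [hRdef, Matrix.det_fromBlocks_zero₁₂, h, mul_zero]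
  have main : ∀ b₁ ∈ proj1Set B, ∀ b₂ ∈ slice2 B b₁, ∀ b₂' ∈ slice2 B b₁, b₂ ≠ b₂' →
      (∑ l₂ ∈ proj2Set L, ((slice1 L l₂).card : ℂ) *
          expv ((intMatCast R₂)⁻¹.mulVec (intVecCast (b₂ - b₂'))) (intVecCast l₂)) = 0 := by
    intro b₁ _ b₂ h2 b₂' h2' hne
    obtain ⟨b, hb, hb1, rfl⟩ := mem_slice2_s11 h2
    obtain ⟨b', hb', hb1', rfl⟩ := mem_slice2_s11 h2'
    have hbb : b ≠ b' := fun h => hne (by rw [h])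
    have h := hH.2 b hb b' hb'
    rw [if_neg hbb] at h
    have hN : (B.card : ℂ) ≠ 0 := by
      exact_mod_cast (Finset.card_pos.2 ⟨b, hb⟩).ne'
    have h := (mul_eq_zero.1 h).resolve_left (inv_ne_zero hN)
    rw [sum_proj2 L (fun l₂ => expv ((intMatCast R₂)⁻¹.mulVec
      (intVecCast (proj2 b - proj2 b'))) (intVecCast l₂)), ← h]
    refine Finset.sum_congr rfl fun l _ => ?_
    have hv : proj1 (b - b') = 0 := by
      have : proj1 (b - b') = proj1 b - proj1 b' := rfl
      rw [this, hb1, hb1', sub_self]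
    rw [expv_mul_conj, ← Matrix.mulVec_sub, ← intVecCast_sub,
      block_inv R₁ R₂ C R hRdef hd hd2 _ hv]
    have hp : proj2 (b - b') = proj2 b - proj2 b' := rfl
    rw [hp]
    simp [expv, rdot, intVecCast, proj2]
  have hLpos : ∀ b₁ ∈ proj1Set B, (L.card : ℂ) ≠ 0 := by
    intro b₁ h
    obtain ⟨b, hb, _⟩ := Finset.mem_image.1 h
    rw [← hH.1]
    exact_mod_cast (Finset.card_pos.2 ⟨b, hb⟩).ne'
  refine ⟨main, fun b₁ hb₁ => ⟨?_, ?_⟩⟩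
  · let v : slice2 B b₁ → (proj2Set L → ℂ) := fun b l =>
      expv ((intMatCast R₂)⁻¹.mulVec (intVecCast b.1)) (intVecCast l.1)
    have hli : LinearIndependent ℂ v := by
      rw [Fintype.linearIndependent_iff]
      intro g hg c
      have h1 : ∑ l : proj2Set L, ((slice1 L l.1).card : ℂ) *
          ((∑ b, g b • v b) l * (starRingEnd ℂ) (v c l)) = 0 := by
        rw [hg]; simp
      have h2 : ∑ l : proj2Set L, ((slice1 L l.1).card : ℂ) *
          ((∑ b, g b • v b) l * (starRingEnd ℂ) (v c l)) =
          ∑ b, g b * ∑ l : proj2Set L, ((slice1 L l.1).card : ℂ) *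
            expv ((intMatCast R₂)⁻¹.mulVec (intVecCast (b.1 - c.1))) (intVecCast l.1) := by
        simp_rw [Finset.mul_sum]
        rw [Finset.sum_comm]
        refine Finset.sum_congr rfl fun l _ => ?_
        rw [Finset.sum_apply, Finset.sum_mul, Finset.mul_sum]
        refine Finset.sum_congr rfl fun b _ => ?_
        rw [intVecCast_sub, Matrix.mulVec_sub, ← expv_mul_conj]
        simp only [Pi.smul_apply, smul_eq_mul, v]
        ring
      rw [h2, Finset.sum_eq_single c] at h1
      · refine (mul_eq_zero.1 h1).resolve_right ?_
        rw [Finset.sum_coe_sort (proj2Set L) (fun l => ((slice1 L l).card : ℂ) *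
            expv ((intMatCast R₂)⁻¹.mulVec (intVecCast (c.1 - c.1))) (intVecCast l)),
          sum_proj2 L (fun l => expv ((intMatCast R₂)⁻¹.mulVec
            (intVecCast (c.1 - c.1))) (intVecCast l))]
        have : ∀ l : Fin s → ℝ,
            expv ((intMatCast R₂)⁻¹.mulVec (intVecCast (c.1 - c.1))) l = 1 := by
          intro l
          rw [intVecCast_sub, sub_self, Matrix.mulVec_zero]
          simp [expv, rdot]
        simp only [this, Finset.sum_const, nsmul_eq_mul, mul_one]
        exact hLpos b₁ hb₁
      · intro b _ hbc
        rw [Finset.sum_coe_sort (proj2Set L) (fun l => ((slice1 L l).card : ℂ) *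
            expv ((intMatCast R₂)⁻¹.mulVec (intVecCast (b.1 - c.1))) (intVecCast l)),
          main b₁ hb₁ b.1 b.2 c.1 c.2 (fun h => hbc (Subtype.ext h)), mul_zero]
      · intro h; exact absurd (Finset.mem_univ c) h
    have := hli.fintype_card_le_finrank
    simpa using this
  · rintro c₂ h c₂' h' ⟨k, hk⟩
    by_contra hne
    have h0 := main b₁ hb₁ c₂ h c₂' h' hne
    rw [hk, intMatCast_mulVec, Matrix.mulVec_mulVec,
      Matrix.nonsing_inv_mul _ (intMatCast_det R₂ hd2), Matrix.one_mulVec,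
      sum_proj2 L (fun l => expv (intVecCast k) (intVecCast l))] at h0
    simp only [expv_int, Finset.sum_const, nsmul_eq_mul, mul_one] at h0
    exact hLpos b₁ hb₁ h0

end
end

section
/- Let R = [[R₁,0],[C,R₂]] be a d×d expanding integer matrix in block lower-triangular form with R₁ ∈ M_r(ℤ) and R₂ ∈ M_{d−r}(ℤ), and let (R,B,L) be a Hadamard triple. Then for every ℓ₂ ∈ π₂(L) and every pair ℓ₁ ≠ ℓ₁' in L₁(ℓ₂), one has Σ_{b₁ ∈ π₁(B)} #B₂(b₁) · e^{2πi⟨R₁⁻¹b₁, ℓ₁−ℓ₁'⟩} = 0. Moreover, for every ℓ₂ ∈ π₂(L), #L₁(ℓ₂) ≤ #π₁(B) and distinct elements of L₁(ℓ₂) are not congruent modulo R₁ᵀ(ℤ^r). -/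
open MeasureTheory Matrix Filter
open scoped BigOperators Classical

noncomputable section

variable {ι : Type*}

lemma expv_add_right [Fintype ι] (x y z : ι → ℝ) : expv x (y + z) = expv x y * expv x z := by
  unfold expv rdot
  rw [← Complex.exp_add]
  congr 1
  simp only [Pi.add_apply, mul_add, Finset.sum_add_distrib]
  push_cast
  ring

lemma expv_conj [Fintype ι] (x y : ι → ℝ) : (starRingEnd ℂ) (expv x y) = expv x (-y) := by
  unfold expv rdot
  rw [← Complex.exp_conj]
  congr 1
  simp [Complex.conj_ofReal, map_ofNat]

lemma expv_sub_right [Fintype ι] (x : ι → ℝ) (y z : ι → ℤ) :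
    expv x (intVecCast (y - z)) =
      (starRingEnd ℂ) (expv x (intVecCast z)) * expv x (intVecCast y) := by
  rw [expv_conj, ← expv_add_right]
  congr 1
  ext i
  simp [intVecCast]
  ring

/-- Row orthogonality from column orthogonality. -/
lemma row_orth [Fintype ι] [DecidableEq ι] (R : Matrix ι ι ℤ)
    (B L : Finset (ι → ℤ)) (hH : IsHadamardTriple R B L) (l : ι → ℤ) (hl : l ∈ L)
    (l' : ι → ℤ) (hl' : l' ∈ L) :
    ∑ b ∈ B, expv ((intMatCast R)⁻¹.mulVec (intVecCast b)) (intVecCast (l - l')) =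
      if l = l' then (B.card : ℂ) else 0 := by
  obtain ⟨hc, h⟩ := hH
  have hN : (B.card : ℂ) ≠ 0 := by
    rw [hc]
    exact_mod_cast (Finset.card_pos.mpr ⟨l, hl⟩).ne'
  let P : Matrix B L ℂ := fun b l => (B.card : ℂ)⁻¹ *
    expv ((intMatCast R)⁻¹.mulVec (intVecCast b.1)) (intVecCast l.1)
  let Q : Matrix L B ℂ := fun l b =>
    (starRingEnd ℂ) (expv ((intMatCast R)⁻¹.mulVec (intVecCast b.1)) (intVecCast l.1))
  have hPQ : P * Q = 1 := by
    ext b b'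
    rw [Matrix.mul_apply, Matrix.one_apply]
    have := h b.1 b.2 b'.1 b'.2
    simp only [Subtype.ext_iff]
    rw [← this, Finset.mul_sum, ← Finset.sum_coe_sort L]
    refine Finset.sum_congr rfl fun x _ => ?_
    simp only [P, Q]
    ring
  have hQP : Q * P = 1 :=
    (Matrix.mul_eq_one_comm_of_card_eq _ _ _ (by simpa using hc)).mp hPQ
  have h2 := congrFun (congrFun hQP ⟨l', hl'⟩) ⟨l, hl⟩
  rw [Matrix.mul_apply, Matrix.one_apply] at h2
  have h3 : ∑ b ∈ B, expv ((intMatCast R)⁻¹.mulVec (intVecCast b)) (intVecCast (l - l')) =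
      (B.card : ℂ) * ∑ b : B, Q ⟨l', hl'⟩ b * P b ⟨l, hl⟩ := by
    rw [Finset.mul_sum, ← Finset.sum_coe_sort B]
    refine Finset.sum_congr rfl fun x _ => ?_
    simp only [P, Q, expv_sub_right]
    field_simp
  rw [h3, h2]
  by_cases e : l = l'
  · simp [e]
  · simp [e, Ne.symm e]

lemma det_ne_zero_of_expanding_s12 [Fintype ι] [DecidableEq ι] (R : Matrix ι ι ℤ)
    (hR : IsExpanding R) : R.det ≠ 0 := by
  intro h0
  have : (0 : ℂ) ∈ spectrum ℂ (R.map (Int.cast : ℤ → ℂ)) := by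
    rw [spectrum.zero_mem_iff, Matrix.isUnit_iff_isUnit_det]
    have : (R.map (Int.cast : ℤ → ℂ)).det = ((R.det : ℤ) : ℂ) :=
      (Int.cast_det R).symm
    rw [this, h0]
    simp
  have := hR 0 this
  simp at this
  linarith

lemma det_intMatCast [Fintype ι] [DecidableEq ι] (R : Matrix ι ι ℤ) :
    (intMatCast R).det = ((R.det : ℤ) : ℝ) := (Int.cast_det R).symm

lemma proj1_inv {r s : ℕ}
    (R₁ : Matrix (Fin r) (Fin r) ℤ) (R₂ : Matrix (Fin s) (Fin s) ℤ)
    (C : Matrix (Fin s) (Fin r) ℤ) (h1 : R₁.det ≠ 0) (h2 : R₂.det ≠ 0)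
    (b : Fin r ⊕ Fin s → ℤ) (i : Fin r) :
    (intMatCast (Matrix.fromBlocks R₁ 0 C R₂))⁻¹.mulVec (intVecCast b) (Sum.inl i) =
      (intMatCast R₁)⁻¹.mulVec (intVecCast (proj1 b)) i := by
  have e : intMatCast (Matrix.fromBlocks R₁ 0 C R₂) =
      Matrix.fromBlocks (intMatCast R₁) 0 (C.map (Int.cast : ℤ → ℝ)) (intMatCast R₂) := by
    simp [intMatCast, Matrix.fromBlocks_map]
  have u1 : IsUnit (intMatCast R₁) := by
    rw [Matrix.isUnit_iff_isUnit_det, det_intMatCast]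
    simpa using h1
  have u2 : IsUnit (intMatCast R₂) := by
    rw [Matrix.isUnit_iff_isUnit_det, det_intMatCast]
    simpa using h2
  rw [e, Matrix.inv_fromBlocks_zero₁₂_of_isUnit_iff _ _ _ (by simp [u1, u2]),
    Matrix.fromBlocks_mulVec]
  simp only [Sum.elim_inl, Matrix.zero_mulVec, add_zero]
  rfl

lemma key_sum {r s : ℕ}
    (R₁ : Matrix (Fin r) (Fin r) ℤ) (R₂ : Matrix (Fin s) (Fin s) ℤ)
    (C : Matrix (Fin s) (Fin r) ℤ) (h1 : R₁.det ≠ 0) (h2 : R₂.det ≠ 0)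
    (B L : Finset (Fin r ⊕ Fin s → ℤ))
    (hH : IsHadamardTriple (Matrix.fromBlocks R₁ 0 C R₂) B L)
    (l₂ : Fin s → ℤ) (l₁ : Fin r → ℤ) (hl : l₁ ∈ slice1 L l₂)
    (l₁' : Fin r → ℤ) (hl' : l₁' ∈ slice1 L l₂) :
    (∑ b₁ ∈ proj1Set B, ((slice2 B b₁).card : ℂ) *
          expv ((intMatCast R₁)⁻¹.mulVec (intVecCast b₁)) (intVecCast (l₁ - l₁'))) =
      if l₁ = l₁' then (B.card : ℂ) else 0 := by
  simp only [slice1, Finset.mem_image, Finset.mem_filter] at hl hl'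
  obtain ⟨l, ⟨hlL, hl2⟩, rfl⟩ := hl
  obtain ⟨l', ⟨hlL', hl2'⟩, rfl⟩ := hl'
  have e : (proj1 l = proj1 l') ↔ l = l' := by
    constructor
    · intro h
      ext (i | i)
      · exact congrFun h i
      · exact congrFun (hl2.trans hl2'.symm) i
    · rintro rfl; rfl
  simp only [e]
  rw [← row_orth _ B L hH l hlL l' hlL']
  rw [← Finset.sum_fiberwise_of_maps_to (s := B) (t := proj1Set B) (g := proj1)
    (fun b hb => Finset.mem_image_of_mem _ hb)]
  refine Finset.sum_congr rfl fun b₁ _ => ?_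
  have hcard : (slice2 B b₁).card = (B.filter (fun a => proj1 a = b₁)).card := by
    unfold slice2
    apply Finset.card_image_of_injOn
    intro x hx y hy hxy
    simp only [Finset.coe_filter, Set.mem_ofPred_eq] at hx hy
    ext (i | i)
    · exact congrFun (hx.2.trans hy.2.symm) i
    · exact congrFun hxy i
  rw [hcard, ← nsmul_eq_mul, ← Finset.sum_const]
  refine Finset.sum_congr rfl fun b hb => ?_
  have hb1 := (Finset.mem_filter.mp hb).2
  subst hb1
  unfold expv
  congr 3
  unfold rdot
  rw [Fintype.sum_sum_type]
  have z : ∀ j : Fin s, intVecCast (l - l') (Sum.inr j) = 0 := by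
    intro j
    have := congrFun (hl2.trans hl2'.symm) j
    simp only [proj2, Function.comp] at this
    simp [intVecCast, this]
  simp only [z, mul_zero, Finset.sum_const_zero, add_zero, proj1_inv R₁ R₂ C h1 h2]
  rfl

lemma expv_congr_one {r : ℕ} (R₁ : Matrix (Fin r) (Fin r) ℤ) (h1 : R₁.det ≠ 0)
    (b k : Fin r → ℤ) :
    expv ((intMatCast R₁)⁻¹.mulVec (intVecCast b)) (intVecCast (R₁ᵀ.mulVec k)) = 1 := by
  have u1 : IsUnit (intMatCast R₁).det := by
    rw [det_intMatCast]
    simpa using h1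
  have : rdot ((intMatCast R₁)⁻¹.mulVec (intVecCast b)) (intVecCast (R₁ᵀ.mulVec k)) =
      ((∑ i, b i * k i : ℤ) : ℝ) := by
    have e : intVecCast (R₁ᵀ.mulVec k) = (intMatCast R₁)ᵀ.mulVec (intVecCast k) := by
      ext i
      simp [intVecCast, intMatCast, Matrix.mulVec, dotProduct]
    change _ ⬝ᵥ _ = _
    rw [e, Matrix.mulVec_transpose, dotProduct_comm, ← Matrix.dotProduct_mulVec,
      Matrix.mulVec_mulVec, Matrix.mul_nonsing_inv _ u1, Matrix.one_mulVec]
    simp [dotProduct, intVecCast, mul_comm]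
  unfold expv
  rw [this, Complex.exp_eq_one_iff]
  refine ⟨∑ i, b i * k i, ?_⟩
  push_cast
  ring

/-- Orthogonality relations for the first components of the spectrum digits. -/
theorem first_component_orthogonality {r s : ℕ}
    (R₁ : Matrix (Fin r) (Fin r) ℤ) (R₂ : Matrix (Fin s) (Fin s) ℤ)
    (C : Matrix (Fin s) (Fin r) ℤ)
    (R : Matrix (Fin r ⊕ Fin s) (Fin r ⊕ Fin s) ℤ)
    (hRdef : R = Matrix.fromBlocks R₁ 0 C R₂)
    (hR : IsExpanding R)
    (B L : Finset (Fin r ⊕ Fin s → ℤ))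
    (hH : IsHadamardTriple R B L) :
    (∀ l₂ ∈ proj2Set L, ∀ l₁ ∈ slice1 L l₂, ∀ l₁' ∈ slice1 L l₂, l₁ ≠ l₁' →
      (∑ b₁ ∈ proj1Set B, ((slice2 B b₁).card : ℂ) *
          expv ((intMatCast R₁)⁻¹.mulVec (intVecCast b₁)) (intVecCast (l₁ - l₁'))) = 0) ∧
    (∀ l₂ ∈ proj2Set L,
      (slice1 L l₂).card ≤ (proj1Set B).card ∧
      (∀ k₁ ∈ slice1 L l₂, ∀ k₁' ∈ slice1 L l₂,
        (∃ k : Fin r → ℤ, k₁ - k₁' = R₁ᵀ.mulVec k) → k₁ = k₁')) := by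
  subst hRdef
  have hd := det_ne_zero_of_expanding_s12 _ hR
  rw [Matrix.det_fromBlocks_zero₁₂] at hd
  have h1 := left_ne_zero_of_mul hd
  have h2 := right_ne_zero_of_mul hd
  have key := key_sum R₁ R₂ C h1 h2 B L hH
  refine ⟨fun l₂ _ l₁ hl l₁' hl' hne => by rw [key l₂ l₁ hl l₁' hl', if_neg hne], ?_⟩
  intro l₂ hl₂
  have hN : (B.card : ℂ) ≠ 0 := by
    obtain ⟨l, hl, -⟩ := Finset.mem_image.mp hl₂
    rw [hH.1]
    exact_mod_cast (Finset.card_pos.mpr ⟨l, hl⟩).ne'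
  constructor
  · let P : Matrix (slice1 L l₂) (proj1Set B) ℂ := fun l b =>
      (starRingEnd ℂ) (expv ((intMatCast R₁)⁻¹.mulVec (intVecCast b.1)) (intVecCast l.1))
    let Q : Matrix (proj1Set B) (slice1 L l₂) ℂ := fun b l =>
      (B.card : ℂ)⁻¹ * ((slice2 B b.1).card : ℂ) *
        expv ((intMatCast R₁)⁻¹.mulVec (intVecCast b.1)) (intVecCast l.1)
    have hPQ : P * Q = 1 := by
      ext l' l
      rw [Matrix.mul_apply, Matrix.one_apply]
      have hk := key l₂ l.1 l.2 l'.1 l'.2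
      have h3 : ∑ b, P l' b * Q b l = (B.card : ℂ)⁻¹ *
          ∑ b₁ ∈ proj1Set B, ((slice2 B b₁).card : ℂ) *
          expv ((intMatCast R₁)⁻¹.mulVec (intVecCast b₁)) (intVecCast (l.1 - l'.1)) := by
        rw [Finset.mul_sum, ← Finset.sum_coe_sort (proj1Set B)]
        refine Finset.sum_congr rfl fun x _ => ?_
        simp only [P, Q, expv_sub_right]
        ring
      rw [h3, hk]
      by_cases e : l = l'
      · simp [e, hN]
      · have e' : ¬ (l.1 = l'.1) := fun h => e (Subtype.ext h)
        simp [e', Ne.symm e]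
    have hr := (Matrix.rank_mul_le_left P Q).trans (Matrix.rank_le_card_width P)
    rw [hPQ, Matrix.rank_one] at hr
    simpa using hr
  · rintro k₁ hk k₁' hk' ⟨k, hkk⟩
    by_contra hne
    have a := key l₂ k₁ hk k₁' hk'
    have b := key l₂ k₁ hk k₁ hk
    rw [if_neg hne, hkk] at a
    have z : k₁ - k₁ = R₁ᵀ.mulVec 0 := by simp
    rw [if_pos rfl, z] at b
    simp only [expv_congr_one R₁ h1] at a b
    exact hN (b.symm.trans a)

end
end

section
/- Let R = [[R₁,0],[C,R₂]] be a d×d expanding integer matrix in block lower-triangular form with R₁ ∈ M_r(ℤ) and R₂ ∈ M_{d−r}(ℤ), and let 𝓛 be a complete set of representatives (mod Rᵀ(ℤ^d)) satisfying: if ℓ, ℓ' ∈ 𝓛 and π₂(ℓ) ≡ π₂(ℓ') (mod R₂ᵀ(ℤ^{d−r})), then π₂(ℓ) = π₂(ℓ'). Then π₂(𝓛) is a complete set of representatives (mod R₂ᵀ(ℤ^{d−r})), and for every ℓ₂ ∈ π₂(𝓛), the set 𝓛₁(ℓ₂) is a complete set of representatives (mod R₁ᵀ(ℤ^r)). -/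
open MeasureTheory Matrix Filter
open scoped BigOperators Classical

noncomputable section

variable {ι : Type*}

/-- The transposed block matrix acts blockwise. -/
theorem fromBlocks_transpose_mulVec_aux {r s : ℕ}
    (R₁ : Matrix (Fin r) (Fin r) ℤ) (R₂ : Matrix (Fin s) (Fin s) ℤ)
    (C : Matrix (Fin s) (Fin r) ℤ) (k : Fin r ⊕ Fin s → ℤ) :
    (Matrix.fromBlocks R₁ 0 C R₂)ᵀ.mulVec k =
      Sum.elim (R₁ᵀ.mulVec (proj1 k) + Cᵀ.mulVec (proj2 k)) (R₂ᵀ.mulVec (proj2 k)) := by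
  rw [Matrix.fromBlocks_transpose, Matrix.fromBlocks_mulVec]
  simp [proj1, proj2]

/-- An expanding matrix has nonzero determinant. -/
theorem det_ne_zero_of_expanding_aux {n : Type*} [Fintype n] [DecidableEq n]
    (R : Matrix n n ℤ) (hR : IsExpanding R) : R.det ≠ 0 := by
  intro h0
  have h : (0 : ℂ) ∈ spectrum ℂ (R.map (Int.cast : ℤ → ℂ)) := by
    rw [spectrum.zero_mem_iff, Matrix.isUnit_iff_isUnit_det]
    have h1 : (R.map (Int.cast : ℤ → ℂ)).det = ((R.det : ℤ) : ℂ) :=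
      (Int.cast_det R).symm
    rw [h1, h0]
    simp
  have := hR 0 h
  norm_num at this

/-- For a `π₂`-injective complete residue system `𝓛` mod `Rᵀ(ℤ^d)`,
`π₂(𝓛)` is a complete residue system mod `R₂ᵀ(ℤ^{d-r})`, and each `𝓛₁(ℓ₂)` is a
complete residue system mod `R₁ᵀ(ℤ^r)`. -/
theorem residues_of_projections {r s : ℕ}
    (R₁ : Matrix (Fin r) (Fin r) ℤ) (R₂ : Matrix (Fin s) (Fin s) ℤ)
    (C : Matrix (Fin s) (Fin r) ℤ)
    (R : Matrix (Fin r ⊕ Fin s) (Fin r ⊕ Fin s) ℤ)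
    (hRdef : R = Matrix.fromBlocks R₁ 0 C R₂)
    (hR : IsExpanding R)
    (𝓛 : Finset (Fin r ⊕ Fin s → ℤ))
    (h𝓛 : IsCompleteResidueSet Rᵀ 𝓛)
    (hinj : ∀ l ∈ 𝓛, ∀ l' ∈ 𝓛,
      (∃ k : Fin s → ℤ, proj2 l - proj2 l' = R₂ᵀ.mulVec k) → proj2 l = proj2 l') :
    IsCompleteResidueSet R₂ᵀ (proj2Set 𝓛) ∧
    ∀ l₂ ∈ proj2Set 𝓛, IsCompleteResidueSet R₁ᵀ (slice1 𝓛 l₂) := by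
  subst hRdef
  have hdet : R₂ᵀ.det ≠ 0 := by
    have h := det_ne_zero_of_expanding_aux _ hR
    rw [Matrix.det_fromBlocks_zero₁₂] at h
    rw [Matrix.det_transpose]
    exact right_ne_zero_of_mul h
  refine ⟨?_, ?_⟩
  · intro v
    obtain ⟨l, ⟨hl, k, hk⟩, -⟩ := h𝓛 (Sum.elim 0 v)
    rw [fromBlocks_transpose_mulVec_aux] at hk
    have hk2 : v - proj2 l = R₂ᵀ.mulVec (proj2 k) := by
      funext i
      simpa [proj2] using congrFun hk (Sum.inr i)
    refine ⟨proj2 l, ⟨Finset.mem_image_of_mem _ hl, _, hk2⟩, ?_⟩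
    rintro y ⟨hy, k', hk'⟩
    obtain ⟨l', hl', rfl⟩ := Finset.mem_image.1 hy
    refine hinj _ hl' _ hl ⟨proj2 k - k', ?_⟩
    rw [Matrix.mulVec_sub, ← hk2, ← hk']
    abel
  · intro l₂ hl₂ v
    obtain ⟨l₀, hl₀, rfl⟩ := Finset.mem_image.1 hl₂
    obtain ⟨l, ⟨hl, k, hk⟩, huniq⟩ := h𝓛 (Sum.elim v (proj2 l₀))
    rw [fromBlocks_transpose_mulVec_aux] at hk
    have hk1 : v - proj1 l = R₁ᵀ.mulVec (proj1 k) + Cᵀ.mulVec (proj2 k) := by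
      funext i
      simpa [proj1] using congrFun hk (Sum.inl i)
    have hk2 : proj2 l₀ - proj2 l = R₂ᵀ.mulVec (proj2 k) := by
      funext i
      simpa [proj2] using congrFun hk (Sum.inr i)
    have heq := hinj _ hl₀ _ hl ⟨_, hk2⟩
    have hz : proj2 k = 0 := by
      apply Matrix.eq_zero_of_mulVec_eq_zero hdet
      rw [← hk2, heq, sub_self]
    rw [hz, Matrix.mulVec_zero, add_zero] at hk1
    refine ⟨proj1 l, ⟨Finset.mem_image_of_mem _ (Finset.mem_filter.2 ⟨hl, heq.symm⟩), _, hk1⟩, ?_⟩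
    rintro y ⟨hy, k', hk'⟩
    obtain ⟨l', hl', rfl⟩ := Finset.mem_image.1 hy
    obtain ⟨hl', he'⟩ := Finset.mem_filter.1 hl'
    rw [huniq l' ⟨hl', Sum.elim k' 0, ?_⟩]
    rw [fromBlocks_transpose_mulVec_aux]
    have e1 : proj1 (Sum.elim k' 0 : Fin r ⊕ Fin s → ℤ) = k' := rfl
    have e2 : proj2 (Sum.elim k' 0 : Fin r ⊕ Fin s → ℤ) = 0 := rfl
    rw [e1, e2, Matrix.mulVec_zero, Matrix.mulVec_zero, add_zero, ← hk']
    funext i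
    rcases i with i | i
    · simp [proj1]
    · have := congrFun he' i
      simp only [proj2, Function.comp] at this
      simp [proj2, this]

end
end
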